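/- arXiv:2208.09911 — 9 statements merged into one kernel-verified Lean document; each statement's English description precedes it below -/
import Mathlib

section
/- Let A₁, A₂, A₁′, A₂′ be 2×2 integer matrices, each with nonzero determinant. For h = 1, 2 let p_h, q_h, r_h, s_h and p_h′, q_h′, r_h′, s_h′ be integers with p_h s_h − q_h r_h = p_h′ s_h′ − q_h′ r_h′ = 1, and write P_h = [[p_h, q_h],[r_h, s_h]] and P_h′ = [[p_h′, q_h′],[r_h′, s_h′]]. Let ξm₁, ξl₁, ξm₂, ξl₂, ξm₁′, ξl₁′, ξm₂′, ξl₂′ be complex numbers satisfying A₁·(ξm₁, ξl₁)ᵀ + A₂·(ξm₂, ξl₂)ᵀ = A₁′·(ξm₁′, ξl₁′)ᵀ + A₂′·(ξm₂′, ξl₂′)ᵀ and p_hξm_h + q_hξl_h = p_h′ξm_h′ + q_h′ξl_h′ = −2π√−1 for h = 1, 2. Set t_h = exp(r_hξm_h + s_hξl_h) and t_h′ = exp(r_h′ξm_h′ + s_h′ξl_h′). Assume t₁t₂ = t₁′t₂′, and assume that whenever integers a, b, c, d satisfy t₁^a t₂^b (t₁′)^c (t₂′)^d = 1 with at least one of a,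 b, c, d equal to zero, then a = b = c = d = 0. Then there exist rational numbers n₂, n₁′, n₂′ such that P₁·A₁⁻¹A₂ = [[det A₂/det A₁, 0],[n₂, 1]]·P₂, P₁·A₁⁻¹A₁′ = [[det A₁′/det A₁, 0],[n₁′, 1]]·P₁′, and P₁·A₁⁻¹A₂′ = [[det A₂′/det A₁, 0],[n₂′, 1]]·P₂′. -/
open Matrix

/-- If `A * P⁻¹` and `B * Q⁻¹` have the same second column, where `det P = det Q = 1`, then
`P * A⁻¹ * B * Q⁻¹` is lower triangular with diagonal entries `det B / det A` and `1`. -/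
theorem exists_mul_inv_mul_eq_lowerTriangular_mul {K : Type*} [Field K]
    (A B P Q : Matrix (Fin 2) (Fin 2) K) (hA : A.det ≠ 0) (hP : P.det = 1) (hQ : Q.det = 1)
    (h : A *ᵥ (P⁻¹ *ᵥ ![0, 1]) = B *ᵥ (Q⁻¹ *ᵥ ![0, 1])) :
    ∃ n : K, P * A⁻¹ * B = !![B.det / A.det, 0; n, 1] * Q := by
  have hAu : IsUnit A.det := isUnit_iff_ne_zero.mpr hA
  have hPu : IsUnit P.det := by simp [hP]
  have hQu : IsUnit Q.det := by simp [hQ]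
  obtain ⟨X, hX⟩ : ∃ X, X = P * A⁻¹ * B * Q⁻¹ := ⟨_, rfl⟩
  have hcol : X *ᵥ ![0, 1] = ![0, 1] := by
    calc X *ᵥ ![0, 1] = (P * A⁻¹) *ᵥ (B *ᵥ (Q⁻¹ *ᵥ ![0, 1])) := by
          simp only [hX, mulVec_mulVec, Matrix.mul_assoc]
      _ = (P * (A⁻¹ * A) * P⁻¹) *ᵥ ![0, 1] := by
          rw [← h]
          simp only [mulVec_mulVec, Matrix.mul_assoc]
      _ = ![0, 1] := by
          rw [nonsing_inv_mul A hAu, Matrix.mul_one, mul_nonsing_inv P hPu, one_mulVec]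
  have h01 : X 0 1 = 0 := by simpa [mulVec, dotProduct] using congrFun hcol 0
  have h11 : X 1 1 = 1 := by simpa [mulVec, dotProduct] using congrFun hcol 1
  have hdet : X.det = B.det / A.det := by
    simp [hX, det_nonsing_inv, hP, hQ, div_eq_mul_inv, mul_comm]
  have h00 : X 0 0 = B.det / A.det := by simpa [det_fin_two, h01, h11] using hdet
  refine ⟨X 1 0, ?_⟩
  rw [← h00, ← h01, ← h11, ← eta_fin_two X, hX,
    nonsing_inv_mul_cancel_right _ _ hQu]

/-- The second column of `A * P⁻¹` for `P = !![p, q; r, s]` of determinant one. -/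
theorem map_mulVec_inv_mulVec_eq (A : Matrix (Fin 2) (Fin 2) ℤ) {p q r s : ℤ}
    (h : p * s - q * r = 1) :
    A.map ((↑) : ℤ → ℚ) *ᵥ ((!![(p : ℚ), (q : ℚ); (r : ℚ), (s : ℚ)])⁻¹ *ᵥ ![0, 1]) =
      fun i => ((A i 1 * p - A i 0 * q : ℤ) : ℚ) := by
  have h' : (p : ℚ) * s - q * r = 1 := mod_cast h
  ext i
  simp [inv_def, det_fin_two, h', mulVec, dotProduct, Fin.sum_univ_two, adjugate_fin_two]
  ring

/-- If `p u + q v = -2πi` and `p s - q r = 1`, then `exp (a u + b v)` is an integral power of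
`exp (r u + s v)`. -/
theorem exp_eq_zpow_of_dehn_filling {p q r s : ℤ} (h : p * s - q * r = 1) {u v : ℂ}
    (hD : (p : ℂ) * u + (q : ℂ) * v = -(2 * (Real.pi : ℂ) * Complex.I)) (a b : ℤ) :
    Complex.exp (a * u + b * v) =
      Complex.exp ((r : ℂ) * u + (s : ℂ) * v) ^ (b * p - a * q) := by
  have h' : (p : ℂ) * s - q * r = 1 := mod_cast h
  rw [← Complex.exp_int_mul, Complex.exp_eq_exp_iff_exists_int]
  refine ⟨b * r - a * s, ?_⟩
  push_cast
  linear_combination (a * s - b * r) * hD - (a * u + b * v) * h'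

/-- If every multiplicative relation among four nonzero numbers with a vanishing exponent is
trivial and `x * y = z * w`, then every relation is a power of this one. -/
theorem exponents_eq_of_zpow_relation {F : Type*} [Field F] {x y z w : F}
    (hx : x ≠ 0) (hy : y ≠ 0) (hz : z ≠ 0) (hw : w ≠ 0) (hxy : x * y = z * w)
    (hind : ∀ a b c d : ℤ, x ^ a * y ^ b * z ^ c * w ^ d = 1 →
      (a = 0 ∨ b = 0 ∨ c = 0 ∨ d = 0) → a = 0 ∧ b = 0 ∧ c = 0 ∧ d = 0)
    {a b c d : ℤ} (h : x ^ a * y ^ b = z ^ c * w ^ d) : a = b ∧ a = c ∧ a = d := by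
  have hpow : x ^ a * y ^ a = z ^ a * w ^ a := by rw [← mul_zpow, ← mul_zpow, hxy]
  have key := hind 0 (b - a) (a - c) (a - d) ?_ (Or.inl rfl)
  · omega
  · rw [zpow_zero, one_mul, zpow_sub₀ hy, zpow_sub₀ hz, zpow_sub₀ hw]
    have := zpow_ne_zero a hx
    have := zpow_ne_zero a hy
    have := zpow_ne_zero c hz
    have := zpow_ne_zero d hw
    field_simp
    refine mul_left_cancel₀ (zpow_ne_zero a hx) ?_
    linear_combination (z ^ a * w ^ a) * h - (z ^ c * w ^ d) * hpow

/-- Coordinate form of Lemma 6.8 (Lemma 21082802) of the paper: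
for a Dehn filling point on `X × X` lying in the algebraic subgroup determined by
the integer matrices `A₁, A₂, A₁', A₂'`, with `t₁t₂ = t₁'t₂'` (equality of pseudo
complex volumes) and the elements of every proper subset of `{t₁, t₂, t₁', t₂'}`
multiplicatively independent, the Dehn filling coefficient matrices are related by
explicit lower-triangular rational matrices. -/
theorem dehn_coefficients_relation_of_equal_pseudo_complex_volume
    (A₁ A₂ A₁' A₂' : Matrix (Fin 2) (Fin 2) ℤ)
    (hA₁ : A₁.det ≠ 0) (hA₂ : A₂.det ≠ 0) (hA₁' : A₁'.det ≠ 0) (hA₂' : A₂'.det ≠ 0)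
    (p₁ q₁ r₁ s₁ p₂ q₂ r₂ s₂ p₁' q₁' r₁' s₁' p₂' q₂' r₂' s₂' : ℤ)
    (hP₁ : p₁ * s₁ - q₁ * r₁ = 1) (hP₂ : p₂ * s₂ - q₂ * r₂ = 1)
    (hP₁' : p₁' * s₁' - q₁' * r₁' = 1) (hP₂' : p₂' * s₂' - q₂' * r₂' = 1)
    (ξm₁ ξl₁ ξm₂ ξl₂ ξm₁' ξl₁' ξm₂' ξl₂' : ℂ)
    (hA : (A₁.map ((↑) : ℤ → ℂ)).mulVec ![ξm₁, ξl₁]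
          + (A₂.map ((↑) : ℤ → ℂ)).mulVec ![ξm₂, ξl₂]
        = (A₁'.map ((↑) : ℤ → ℂ)).mulVec ![ξm₁', ξl₁']
          + (A₂'.map ((↑) : ℤ → ℂ)).mulVec ![ξm₂', ξl₂'])
    (hD₁ : (p₁ : ℂ) * ξm₁ + (q₁ : ℂ) * ξl₁ = -(2 * (Real.pi : ℂ) * Complex.I))
    (hD₂ : (p₂ : ℂ) * ξm₂ + (q₂ : ℂ) * ξl₂ = -(2 * (Real.pi : ℂ) * Complex.I))
    (hD₁' : (p₁' : ℂ) * ξm₁' + (q₁' : ℂ) * ξl₁' = -(2 * (Real.pi : ℂ) * Complex.I))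
    (hD₂' : (p₂' : ℂ) * ξm₂' + (q₂' : ℂ) * ξl₂' = -(2 * (Real.pi : ℂ) * Complex.I))
    (t₁ t₂ t₁' t₂' : ℂ)
    (ht₁ : t₁ = Complex.exp ((r₁ : ℂ) * ξm₁ + (s₁ : ℂ) * ξl₁))
    (ht₂ : t₂ = Complex.exp ((r₂ : ℂ) * ξm₂ + (s₂ : ℂ) * ξl₂))
    (ht₁' : t₁' = Complex.exp ((r₁' : ℂ) * ξm₁' + (s₁' : ℂ) * ξl₁'))
    (ht₂' : t₂' = Complex.exp ((r₂' : ℂ) * ξm₂' + (s₂' : ℂ) * ξl₂'))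
    (hvol : t₁ * t₂ = t₁' * t₂')
    (hind : ∀ a b c d : ℤ,
        t₁ ^ a * t₂ ^ b * t₁' ^ c * t₂' ^ d = 1 →
        (a = 0 ∨ b = 0 ∨ c = 0 ∨ d = 0) →
        a = 0 ∧ b = 0 ∧ c = 0 ∧ d = 0) :
    ∃ n₂ n₁' n₂' : ℚ,
      !![(p₁ : ℚ), (q₁ : ℚ); (r₁ : ℚ), (s₁ : ℚ)]
          * (A₁.map ((↑) : ℤ → ℚ))⁻¹ * (A₂.map ((↑) : ℤ → ℚ))
        = !![(A₂.det : ℚ) / (A₁.det : ℚ), 0; n₂, 1]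
          * !![(p₂ : ℚ), (q₂ : ℚ); (r₂ : ℚ), (s₂ : ℚ)] ∧
      !![(p₁ : ℚ), (q₁ : ℚ); (r₁ : ℚ), (s₁ : ℚ)]
          * (A₁.map ((↑) : ℤ → ℚ))⁻¹ * (A₁'.map ((↑) : ℤ → ℚ))
        = !![(A₁'.det : ℚ) / (A₁.det : ℚ), 0; n₁', 1]
          * !![(p₁' : ℚ), (q₁' : ℚ); (r₁' : ℚ), (s₁' : ℚ)] ∧
      !![(p₁ : ℚ), (q₁ : ℚ); (r₁ : ℚ), (s₁ : ℚ)]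
          * (A₁.map ((↑) : ℤ → ℚ))⁻¹ * (A₂'.map ((↑) : ℤ → ℚ))
        = !![(A₂'.det : ℚ) / (A₁.det : ℚ), 0; n₂', 1]
          * !![(p₂' : ℚ), (q₂' : ℚ); (r₂' : ℚ), (s₂' : ℚ)] := by
  have hk (i : Fin 2) : A₁ i 1 * p₁ - A₁ i 0 * q₁ = A₂ i 1 * p₂ - A₂ i 0 * q₂ ∧
      A₁ i 1 * p₁ - A₁ i 0 * q₁ = A₁' i 1 * p₁' - A₁' i 0 * q₁' ∧
      A₁ i 1 * p₁ - A₁ i 0 * q₁ = A₂' i 1 * p₂' - A₂' i 0 * q₂' := by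
    have hne {t z : ℂ} (h : t = Complex.exp z) : t ≠ 0 := h ▸ Complex.exp_ne_zero z
    refine exponents_eq_of_zpow_relation (hne ht₁) (hne ht₂) (hne ht₁') (hne ht₂') hvol hind ?_
    rw [ht₁, ht₂, ht₁', ht₂', ← exp_eq_zpow_of_dehn_filling hP₁ hD₁,
      ← exp_eq_zpow_of_dehn_filling hP₂ hD₂, ← exp_eq_zpow_of_dehn_filling hP₁' hD₁',
      ← exp_eq_zpow_of_dehn_filling hP₂' hD₂', ← Complex.exp_add, ← Complex.exp_add]
    congr 1
    have hAi := congrFun hA i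
    fin_cases i <;> simpa [mulVec, dotProduct, Fin.sum_univ_two] using hAi
  have hrel {B : Matrix (Fin 2) (Fin 2) ℤ} {p q r s : ℤ} (hQ : p * s - q * r = 1)
      (h : ∀ i, A₁ i 1 * p₁ - A₁ i 0 * q₁ = B i 1 * p - B i 0 * q) :
      ∃ n : ℚ, !![(p₁ : ℚ), (q₁ : ℚ); (r₁ : ℚ), (s₁ : ℚ)]
          * (A₁.map ((↑) : ℤ → ℚ))⁻¹ * (B.map ((↑) : ℤ → ℚ))
        = !![(B.det : ℚ) / (A₁.det : ℚ), 0; n, 1]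
          * !![(p : ℚ), (q : ℚ); (r : ℚ), (s : ℚ)] := by
    have hdet (M : Matrix (Fin 2) (Fin 2) ℤ) : (M.map ((↑) : ℤ → ℚ)).det = (M.det : ℚ) :=
      (Int.cast_det M).symm
    rw [← hdet, ← hdet]
    refine exists_mul_inv_mul_eq_lowerTriangular_mul _ _ _ _ ?_ ?_ ?_ ?_
    · rw [hdet]
      exact_mod_cast hA₁
    · rw [det_fin_two_of]
      exact_mod_cast hP₁
    · rw [det_fin_two_of]
      exact_mod_cast hQ
    · rw [map_mulVec_inv_mulVec_eq A₁ hP₁, map_mulVec_inv_mulVec_eq B hQ]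
      exact funext fun i => congrArg _ (h i)
  obtain ⟨n₂, h₂⟩ := hrel hP₂ fun i => (hk i).1
  obtain ⟨n₁', h₁'⟩ := hrel hP₁' fun i => (hk i).2.1
  obtain ⟨n₂', h₂'⟩ := hrel hP₂' fun i => (hk i).2.2
  exact ⟨n₂, n₁', n₂', h₂, h₁', h₂'⟩
end

section
/- Let A₁′, A₁, A₂ be 2×2 integer matrices with nonzero determinants. Let p₁, q₁, r₁, s₁, p₂, q₂, r₂, s₂, p₁′, q₁′, r₁′, s₁′ be integers with p₁s₁ − q₁r₁ = p₂s₂ − q₂r₂ = p₁′s₁′ − q₁′r₁′ = 1, and write P₁ = [[p₁, q₁],[r₁, s₁]], P₂ = [[p₂, q₂],[r₂, s₂]], P₁′ = [[p₁′, q₁′],[r₁′, s₁′]]. Let ξm₁, ξl₁, ξm₂, ξl₂, ξm₁′, ξl₁′ be complex numbers with A₁′·(ξm₁′, ξl₁′)ᵀ = A₁·(ξm₁, ξl₁)ᵀ + A₂·(ξm₂, ξl₂)ᵀ and p₁ξm₁ + q₁ξl₁ = p₂ξm₂ + q₂ξl₂ = p₁′ξm₁′ + q₁′ξl₁′ = −2π√−1.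 Set λ₁ = r₁ξm₁ + s₁ξl₁, λ₂ = r₂ξm₂ + s₂ξl₂, t₁ = exp(λ₁), t₂ = exp(λ₂), t₁′ = exp(r₁′ξm₁′ + s₁′ξl₁′). Assume there exist l ∈ ℚ and a root of unity ε with exp(l(λ₁ + λ₂)) = ε·t₁′, and assume that whenever integers a, b, c satisfy t₁^a t₂^b (t₁′)^c = 1 with at least one of a, b, c equal to zero, then a = b = c = 0. Then l ≠ 0 and there exist rational numbers n₁, n₂ such that P₁′·(A₁′)⁻¹A₁ = [[det A₁/(l·det A₁′), 0],[n₁, l]]·P₁ and P₁′·(A₁′)⁻¹A₂ = [[det A₂/(l·det A₁′), 0],[n₂, l]]·P₂. -/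
open Matrix

/-- If `exp x` and `exp y` are multiplicatively independent, then `x`, `y` and `2πi` are linearly
independent over `ℚ`, as far as the coefficients of `x` and `y` are concerned. -/
theorem rat_coeffs_eq_zero_of_exp_multiplicatively_independent {x y : ℂ}
    (hind : ∀ a b : ℤ, Complex.exp x ^ a * Complex.exp y ^ b = 1 → a = 0 ∧ b = 0)
    {u v w : ℚ} (h : (u : ℂ) * x + v * y = w * (2 * Real.pi * Complex.I)) : u = 0 ∧ v = 0 := by
  have hu := u.den_nz
  have hv := v.den_nz
  have hw := w.den_nz
  have hcast (q : ℚ) : (q : ℂ) * (q.den : ℂ) = q.num := by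
    exact_mod_cast Rat.mul_den_eq_num q
  have key : Complex.exp x ^ (u.num * v.den * w.den) * Complex.exp y ^ (v.num * u.den * w.den)
      = 1 := by
    rw [← Complex.exp_int_mul, ← Complex.exp_int_mul, ← Complex.exp_add, Complex.exp_eq_one_iff]
    refine ⟨w.num * u.den * v.den, ?_⟩
    push_cast
    rw [← hcast u, ← hcast v, ← hcast w]
    linear_combination (u.den : ℂ) * v.den * w.den * h
  simpa [hu, hv, hw] using hind _ _ key

/-- A Dehn filling point is recovered from the filling equation and the core holonomy. -/
theorem eq_mulVec_of_filling_equation {p q r s : ℤ} (hP : p * s - q * r = 1) {m n z lam : ℂ}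
    (hD : (p : ℂ) * m + q * n = z) (hlam : lam = (r : ℂ) * m + s * n) :
    m = s * z - q * lam ∧ n = p * lam - r * z := by
  have hP' : (p : ℂ) * s - q * r = 1 := by exact_mod_cast hP
  subst hD hlam
  constructor
  · linear_combination -m * hP'
  · linear_combination -n * hP'

/-- The matrix relation after changing coordinates by unimodular matrices: if the upper right entry
of `Q P⁻¹` vanishes and its lower right entry is `l`, then `Q = [[det Q / l, 0], [n, l]] P`. -/
theorem exists_eq_lowerTriangular_mul {p q r s : ℤ} (hP : p * s - q * r = 1)
    {Q : Matrix (Fin 2) (Fin 2) ℚ} {l : ℚ} (hQ : Q.det ≠ 0)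
    (hb : Q 0 1 * p - Q 0 0 * q = 0) (hd : Q 1 1 * p - Q 1 0 * q = l) :
    l ≠ 0 ∧ ∃ n : ℚ,
      Q = !![Q.det / l, 0; n, l] * !![(p : ℚ), (q : ℚ); (r : ℚ), (s : ℚ)] := by
  have hP' : (p : ℚ) * s - q * r = 1 := by exact_mod_cast hP
  have hdet : Q.det = (Q 0 0 * s - Q 0 1 * r) * l := by
    rw [Matrix.det_fin_two, ← hd]
    linear_combination (-(Q 0 0 * Q 1 1 - Q 0 1 * Q 1 0)) * hP' - (Q 1 0 * s - Q 1 1 * r) * hb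
  have hl : l ≠ 0 := by
    rintro rfl
    exact hQ (by simpa using hdet)
  refine ⟨hl, Q 1 0 * s - Q 1 1 * r, ?_⟩
  rw [hdet, mul_div_cancel_right₀ _ hl, ← hd]
  ext i j
  fin_cases i <;> fin_cases j <;> simp [Matrix.mul_apply, Fin.sum_univ_two]
  · linear_combination (-Q 0 0) * hP' + r * hb
  · linear_combination (-Q 0 1) * hP' + s * hb
  · linear_combination (-Q 1 0) * hP'
  · linear_combination (-Q 1 1) * hP'

/-- Coordinate form of Lemma 6.12 (Lemma 22041320) of the paper:
for a common Dehn filling point of a 2-cusped manifold (core holonomies `t₁, t₂`)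
and a 1-cusped manifold (core holonomy `t₁'`) lying on the algebraic subgroup
determined by `A₁', A₁, A₂`, if `exp (l(lam₁ + lam₂)) = ε · t₁'` for some `l ∈ ℚ` and a
root of unity `ε`, and the elements of every proper subset of `{t₁, t₂, t₁'}` are
multiplicatively independent, then the Dehn filling coefficients are related by
explicit lower-triangular rational matrices. -/
theorem dehn_coefficients_relation_with_one_cusped_manifold
    (A₁' A₁ A₂ : Matrix (Fin 2) (Fin 2) ℤ)
    (hA₁' : A₁'.det ≠ 0) (hA₁ : A₁.det ≠ 0) (hA₂ : A₂.det ≠ 0)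
    (p₁ q₁ r₁ s₁ p₂ q₂ r₂ s₂ p₁' q₁' r₁' s₁' : ℤ)
    (hP₁ : p₁ * s₁ - q₁ * r₁ = 1) (hP₂ : p₂ * s₂ - q₂ * r₂ = 1)
    (hP₁' : p₁' * s₁' - q₁' * r₁' = 1)
    (ξm₁ ξl₁ ξm₂ ξl₂ ξm₁' ξl₁' : ℂ)
    (hA : (A₁'.map ((↑) : ℤ → ℂ)).mulVec ![ξm₁', ξl₁']
        = (A₁.map ((↑) : ℤ → ℂ)).mulVec ![ξm₁, ξl₁]
          + (A₂.map ((↑) : ℤ → ℂ)).mulVec ![ξm₂, ξl₂])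
    (hD₁ : (p₁ : ℂ) * ξm₁ + (q₁ : ℂ) * ξl₁ = -(2 * (Real.pi : ℂ) * Complex.I))
    (hD₂ : (p₂ : ℂ) * ξm₂ + (q₂ : ℂ) * ξl₂ = -(2 * (Real.pi : ℂ) * Complex.I))
    (hD₁' : (p₁' : ℂ) * ξm₁' + (q₁' : ℂ) * ξl₁' = -(2 * (Real.pi : ℂ) * Complex.I))
    (lam₁ lam₂ : ℂ)
    (hlam₁ : lam₁ = (r₁ : ℂ) * ξm₁ + (s₁ : ℂ) * ξl₁)
    (hlam₂ : lam₂ = (r₂ : ℂ) * ξm₂ + (s₂ : ℂ) * ξl₂)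
    (t₁ t₂ t₁' : ℂ)
    (ht₁ : t₁ = Complex.exp lam₁) (ht₂ : t₂ = Complex.exp lam₂)
    (ht₁' : t₁' = Complex.exp ((r₁' : ℂ) * ξm₁' + (s₁' : ℂ) * ξl₁'))
    (l : ℚ) (ε : ℂ) (hε : ∃ N : ℕ, 0 < N ∧ ε ^ N = 1)
    (hrel : Complex.exp ((l : ℂ) * (lam₁ + lam₂)) = ε * t₁')
    (hind : ∀ a b c : ℤ,
        t₁ ^ a * t₂ ^ b * t₁' ^ c = 1 →
        (a = 0 ∨ b = 0 ∨ c = 0) →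
        a = 0 ∧ b = 0 ∧ c = 0) :
    l ≠ 0 ∧
    ∃ n₁ n₂ : ℚ,
      !![(p₁' : ℚ), (q₁' : ℚ); (r₁' : ℚ), (s₁' : ℚ)]
          * (A₁'.map ((↑) : ℤ → ℚ))⁻¹ * (A₁.map ((↑) : ℤ → ℚ))
        = !![(A₁.det : ℚ) / (l * (A₁'.det : ℚ)), 0; n₁, l]
          * !![(p₁ : ℚ), (q₁ : ℚ); (r₁ : ℚ), (s₁ : ℚ)] ∧
      !![(p₁' : ℚ), (q₁' : ℚ); (r₁' : ℚ), (s₁' : ℚ)]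
          * (A₁'.map ((↑) : ℤ → ℚ))⁻¹ * (A₂.map ((↑) : ℤ → ℚ))
        = !![(A₂.det : ℚ) / (l * (A₁'.det : ℚ)), 0; n₂, l]
          * !![(p₂ : ℚ), (q₂ : ℚ); (r₂ : ℚ), (s₂ : ℚ)] := by
  set P' : Matrix (Fin 2) (Fin 2) ℚ := !![(p₁' : ℚ), (q₁' : ℚ); (r₁' : ℚ), (s₁' : ℚ)] with hP'
  set C := (A₁'.map ((↑) : ℤ → ℚ))⁻¹ with hC
  have hdet (A : Matrix (Fin 2) (Fin 2) ℤ) : (A.map ((↑) : ℤ → ℚ)).det = A.det := by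
    simp [Matrix.det_fin_two]
  have hdetP : P'.det = 1 := by
    simp only [hP', Matrix.det_fin_two_of]
    exact_mod_cast hP₁'
  have hA₁'_ne : (A₁'.det : ℚ) ≠ 0 := by exact_mod_cast hA₁'
  have hCA : C * A₁'.map ((↑) : ℤ → ℚ) = 1 :=
    Matrix.nonsing_inv_mul _ (by rw [hdet]; exact hA₁'_ne.isUnit)
  have hdetQ (A : Matrix (Fin 2) (Fin 2) ℤ) :
      (P' * C * A.map ((↑) : ℤ → ℚ)).det = A.det / A₁'.det := by
    rw [Matrix.det_mul, Matrix.det_mul, hdetP, hdet, hC, Matrix.det_nonsing_inv, hdet,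
      Ring.inverse_eq_inv']
    ring
  have hQne {A : Matrix (Fin 2) (Fin 2) ℤ} (hA : A.det ≠ 0) :
      (P' * C * A.map ((↑) : ℤ → ℚ)).det ≠ 0 := by
    rw [hdetQ]
    exact div_ne_zero (by exact_mod_cast hA) hA₁'_ne
  have hcast (A : Matrix (Fin 2) (Fin 2) ℤ) : A.map ((↑) : ℤ → ℂ)
      = (A.map ((↑) : ℤ → ℚ)).map (Rat.castHom ℂ) := by
    ext i j
    simp
  have hQ : (P'.map (Rat.castHom ℂ)) *ᵥ ![ξm₁', ξl₁']
      = ((P' * C * A₁.map ((↑) : ℤ → ℚ)).map (Rat.castHom ℂ)) *ᵥ ![ξm₁, ξl₁]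
        + ((P' * C * A₂.map ((↑) : ℤ → ℚ)).map (Rat.castHom ℂ)) *ᵥ ![ξm₂, ξl₂] := by
    have h := congrArg (fun v => ((P' * C).map (Rat.castHom ℂ)) *ᵥ v) hA
    simpa only [hcast, Matrix.mulVec_add, Matrix.mulVec_mulVec, ← Matrix.map_mul,
      Matrix.mul_assoc, hCA, Matrix.mul_one] using h
  obtain ⟨hm₁, hn₁⟩ := eq_mulVec_of_filling_equation hP₁ hD₁ hlam₁
  obtain ⟨hm₂, hn₂⟩ := eq_mulVec_of_filling_equation hP₂ hD₂ hlam₂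
  have hind₂ (a b : ℤ) (h : Complex.exp lam₁ ^ a * Complex.exp lam₂ ^ b = 1) :
      a = 0 ∧ b = 0 := by
    have := hind a b 0 (by simpa [ht₁, ht₂] using h) (by simp)
    exact ⟨this.1, this.2.1⟩
  obtain ⟨w, hw⟩ : ∃ w : ℚ, (l : ℂ) * (lam₁ + lam₂)
      = ((r₁' : ℂ) * ξm₁' + s₁' * ξl₁') + w * (2 * Real.pi * Complex.I) := by
    obtain ⟨N, hN, hεN⟩ := hε
    have h1 : Complex.exp (N * ((l : ℂ) * (lam₁ + lam₂)))
        = Complex.exp (N * ((r₁' : ℂ) * ξm₁' + s₁' * ξl₁')) := by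
      rw [Complex.exp_nat_mul, Complex.exp_nat_mul, hrel, mul_pow, hεN, one_mul, ht₁']
    obtain ⟨k, hk⟩ := Complex.exp_eq_exp_iff_exists_int.mp h1
    have hN' : (N : ℂ) ≠ 0 := by exact_mod_cast hN.ne'
    refine ⟨k / N, ?_⟩
    push_cast
    field_simp
    linear_combination hk
  have hne₁ := hQne hA₁
  have hne₂ := hQne hA₂
  have hdiv (A : Matrix (Fin 2) (Fin 2) ℤ) : (A.det : ℚ) / (l * A₁'.det)
      = (P' * C * A.map ((↑) : ℤ → ℚ)).det / l := by
    rw [hdetQ, div_div, mul_comm l]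
  rw [hdiv, hdiv]
  generalize P' * C * A₁.map ((↑) : ℤ → ℚ) = Q₁ at hQ hne₁ ⊢
  generalize P' * C * A₂.map ((↑) : ℤ → ℚ) = Q₂ at hQ hne₂ ⊢
  have hrow₀ := congrFun hQ 0
  have hrow₁ := congrFun hQ 1
  simp [hP', Matrix.mulVec, dotProduct, Fin.sum_univ_two] at hrow₀ hrow₁
  rw [hD₁'] at hrow₀
  rw [hm₁, hn₁, hm₂, hn₂] at hrow₀ hrow₁
  obtain ⟨hb₁, hb₂⟩ := rat_coeffs_eq_zero_of_exp_multiplicatively_independent hind₂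
    (u := Q₁ 0 1 * p₁ - Q₁ 0 0 * q₁) (v := Q₂ 0 1 * p₂ - Q₂ 0 0 * q₂)
    (w := Q₁ 0 0 * s₁ - Q₁ 0 1 * r₁ + (Q₂ 0 0 * s₂ - Q₂ 0 1 * r₂) - 1) (by
      push_cast
      linear_combination -hrow₀)
  obtain ⟨hd₁, hd₂⟩ := rat_coeffs_eq_zero_of_exp_multiplicatively_independent hind₂
    (u := Q₁ 1 1 * p₁ - Q₁ 1 0 * q₁ - l) (v := Q₂ 1 1 * p₂ - Q₂ 1 0 * q₂ - l)
    (w := Q₁ 1 0 * s₁ - Q₁ 1 1 * r₁ + (Q₂ 1 0 * s₂ - Q₂ 1 1 * r₂) - w) (by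
      push_cast
      linear_combination -hrow₁ - hw)
  obtain ⟨hl, n₁, hn₁⟩ := exists_eq_lowerTriangular_mul hP₁ hne₁ hb₁ (sub_eq_zero.mp hd₁)
  obtain ⟨-, n₂, hn₂⟩ := exists_eq_lowerTriangular_mul hP₂ hne₂ hb₂ (sub_eq_zero.mp hd₂)
  exact ⟨hl, n₁, n₂, hn₁, hn₂⟩
end

section
/- Let A₁, A₂, A₃, A₄ be 2×2 rational matrices. Let ξm₁, ξl₁, ξm₂, ξl₂ be complex numbers and define (ξm₁′, ξl₁′)ᵀ = A₁·(ξm₁, ξl₁)ᵀ + A₂·(ξm₂, ξl₂)ᵀ and (ξm₂′, ξl₂′)ᵀ = A₃·(ξm₁, ξl₁)ᵀ + A₄·(ξm₂, ξl₂)ᵀ. Let p₁, q₁, r₁, s₁, p₂, q₂, r₂, s₂ be integers with p₁s₁ − q₁r₁ = p₂s₂ − q₂r₂ = 1 and let p₁′, q₁′, p₂′, q₂′ be integers, such that p_hξm_h + q_hξl_h = −2π√−1 and p_h′ξm_h′ + q_h′ξl_h′ = −2π√−1 for h = 1, 2. If t₁ = exp(r₁ξm₁ + s₁ξl₁) and t₂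 = exp(r₂ξm₂ + s₂ξl₂) are multiplicatively independent, then there exist rational numbers k₁, k₂, k₃, k₄ such that (p₁′, q₁′)·A₁ = k₁·(p₁, q₁), (p₁′, q₁′)·A₂ = k₂·(p₂, q₂), (p₂′, q₂′)·A₃ = k₃·(p₁, q₁), (p₂′, q₂′)·A₄ = k₄·(p₂, q₂), and k₁ + k₂ = k₃ + k₄ = 1. -/
open Matrix

/-- Logarithms of multiplicatively independent numbers are linearly independent over `ℚ`
modulo rational multiples of `2πi`. -/
lemma rat_relation_trivial_of_exp_multiplicatively_independent {u₁ u₂ : ℂ}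
    (hind : ∀ a b : ℤ, Complex.exp u₁ ^ a * Complex.exp u₂ ^ b = 1 → a = 0 ∧ b = 0)
    {c₁ c₂ d : ℚ} (h : (c₁ : ℂ) * u₁ + c₂ * u₂ = d * (2 * (Real.pi : ℂ) * Complex.I)) :
    c₁ = 0 ∧ c₂ = 0 ∧ d = 0 := by
  have h₁ : (c₁ : ℂ) * c₁.den = c₁.num := by exact_mod_cast Rat.mul_den_eq_num c₁
  have h₂ : (c₂ : ℂ) * c₂.den = c₂.num := by exact_mod_cast Rat.mul_den_eq_num c₂
  have h₃ : (d : ℂ) * d.den = d.num := by exact_mod_cast Rat.mul_den_eq_num d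
  obtain ⟨ha, hb⟩ := hind (c₁.num * c₂.den * d.den) (c₂.num * c₁.den * d.den) (by
    rw [← Complex.exp_int_mul, ← Complex.exp_int_mul, ← Complex.exp_add, Complex.exp_eq_one_iff]
    refine ⟨d.num * c₁.den * c₂.den, ?_⟩
    push_cast
    rw [← h₁, ← h₂, ← h₃]
    linear_combination (c₁.den * c₂.den * d.den : ℂ) * h)
  have hc₁ : c₁ = 0 := by simpa using ha
  have hc₂ : c₂ = 0 := by simpa using hb
  refine ⟨hc₁, hc₂, ?_⟩
  simpa [hc₁, hc₂, Complex.two_pi_I_ne_zero] using h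

/-- A rational row transforming a Dehn filling point into one with the same filling relation is
a combination of the rows of filling coefficients, with weights summing to `1`. -/
lemma exists_weights_of_dehn_row
    (A B : Matrix (Fin 2) (Fin 2) ℚ) (ξm₁ ξl₁ ξm₂ ξl₂ ξm' ξl' : ℂ)
    (hdef : ![ξm', ξl'] =
        (A.map ((↑) : ℚ → ℂ)).mulVec ![ξm₁, ξl₁]
          + (B.map ((↑) : ℚ → ℂ)).mulVec ![ξm₂, ξl₂])
    (p₁ q₁ r₁ s₁ p₂ q₂ r₂ s₂ : ℤ)
    (hP₁ : p₁ * s₁ - q₁ * r₁ = 1) (hP₂ : p₂ * s₂ - q₂ * r₂ = 1) (p' q' : ℤ)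
    (hD₁ : (p₁ : ℂ) * ξm₁ + (q₁ : ℂ) * ξl₁ = -(2 * (Real.pi : ℂ) * Complex.I))
    (hD₂ : (p₂ : ℂ) * ξm₂ + (q₂ : ℂ) * ξl₂ = -(2 * (Real.pi : ℂ) * Complex.I))
    (hD' : (p' : ℂ) * ξm' + (q' : ℂ) * ξl' = -(2 * (Real.pi : ℂ) * Complex.I))
    (hind : ∀ a b : ℤ, Complex.exp ((r₁ : ℂ) * ξm₁ + (s₁ : ℂ) * ξl₁) ^ a *
      Complex.exp ((r₂ : ℂ) * ξm₂ + (s₂ : ℂ) * ξl₂) ^ b = 1 → a = 0 ∧ b = 0) :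
    ∃ k₁ k₂ : ℚ,
      Matrix.vecMul ![(p' : ℚ), (q' : ℚ)] A = k₁ • ![(p₁ : ℚ), (q₁ : ℚ)] ∧
      Matrix.vecMul ![(p' : ℚ), (q' : ℚ)] B = k₂ • ![(p₂ : ℚ), (q₂ : ℚ)] ∧ k₁ + k₂ = 1 := by
  have hm : ξm' = A 0 0 * ξm₁ + A 0 1 * ξl₁ + (B 0 0 * ξm₂ + B 0 1 * ξl₂) := by
    simpa [Matrix.mulVec, dotProduct, Fin.sum_univ_two] using congrFun hdef 0
  have hl : ξl' = A 1 0 * ξm₁ + A 1 1 * ξl₁ + (B 1 0 * ξm₂ + B 1 1 * ξl₂) := by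
    simpa [Matrix.mulVec, dotProduct, Fin.sum_univ_two] using congrFun hdef 1
  obtain ⟨a₀, ha₀⟩ : ∃ x : ℚ, x = p' * A 0 0 + q' * A 1 0 := ⟨_, rfl⟩
  obtain ⟨a₁, ha₁⟩ : ∃ x : ℚ, x = p' * A 0 1 + q' * A 1 1 := ⟨_, rfl⟩
  obtain ⟨b₀, hb₀⟩ : ∃ x : ℚ, x = p' * B 0 0 + q' * B 1 0 := ⟨_, rfl⟩
  obtain ⟨b₁, hb₁⟩ : ∃ x : ℚ, x = p' * B 0 1 + q' * B 1 1 := ⟨_, rfl⟩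
  have hrow : (a₀ : ℂ) * ξm₁ + a₁ * ξl₁ + (b₀ * ξm₂ + b₁ * ξl₂) =
      -(2 * (Real.pi : ℂ) * Complex.I) := by
    rw [← hD', hm, hl, ha₀, ha₁, hb₀, hb₁]
    push_cast
    ring
  have hC₁ : (p₁ * s₁ - q₁ * r₁ : ℂ) = 1 := by exact_mod_cast hP₁
  have hC₂ : (p₂ * s₂ - q₂ * r₂ : ℂ) = 1 := by exact_mod_cast hP₂
  have hQ₁ : (p₁ * s₁ - q₁ * r₁ : ℚ) = 1 := by exact_mod_cast hP₁
  have hQ₂ : (p₂ * s₂ - q₂ * r₂ : ℚ) = 1 := by exact_mod_cast hP₂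
  obtain ⟨hc₁, hc₂, hd⟩ := rat_relation_trivial_of_exp_multiplicatively_independent hind
    (c₁ := a₁ * p₁ - a₀ * q₁) (c₂ := b₁ * p₂ - b₀ * q₂)
    (d := a₀ * s₁ - a₁ * r₁ + (b₀ * s₂ - b₁ * r₂) - 1) (by
      push_cast
      linear_combination hrow - (a₀ * s₁ - a₁ * r₁ : ℂ) * hD₁ - (b₀ * s₂ - b₁ * r₂ : ℂ) * hD₂
        + (a₀ * ξm₁ + a₁ * ξl₁) * hC₁ + (b₀ * ξm₂ + b₁ * ξl₂) * hC₂)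
  refine ⟨a₀ * s₁ - a₁ * r₁, b₀ * s₂ - b₁ * r₂, ?_, ?_, by linear_combination hd⟩
  · ext i
    fin_cases i <;> simp [Matrix.vecMul, dotProduct, Fin.sum_univ_two, ← ha₀, ← ha₁]
    · linear_combination r₁ * hc₁ - a₀ * hQ₁
    · linear_combination s₁ * hc₁ - a₁ * hQ₁
  · ext i
    fin_cases i <;> simp [Matrix.vecMul, dotProduct, Fin.sum_univ_two, ← hb₀, ← hb₁]
    · linear_combination r₂ * hc₂ - b₀ * hQ₂
    · linear_combination s₂ * hc₂ - b₁ * hQ₂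

/-- Coordinate form of part (1) of Lemma 7.2 (Lemma 20092003) of the paper:
if the block matrix `[[A₁, A₂],[A₃, A₄]]` transforms a Dehn filling point with
coefficients `(p₁/q₁, p₂/q₂)` into one with coefficients `(p₁'/q₁', p₂'/q₂')` and
the core holonomies `t₁, t₂` of the first filling are multiplicatively
independent, then there exist rationals `k₁, k₂, k₃, k₄` with
`(pₕ', qₕ')·A = k·(p, q)` and `k₁ + k₂ = k₃ + k₄ = 1`. -/
theorem rows_of_block_matrix_transforming_dehn_points
    (A₁ A₂ A₃ A₄ : Matrix (Fin 2) (Fin 2) ℚ)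
    (ξm₁ ξl₁ ξm₂ ξl₂ ξm₁' ξl₁' ξm₂' ξl₂' : ℂ)
    (hdef₁ : ![ξm₁', ξl₁'] =
        (A₁.map ((↑) : ℚ → ℂ)).mulVec ![ξm₁, ξl₁]
          + (A₂.map ((↑) : ℚ → ℂ)).mulVec ![ξm₂, ξl₂])
    (hdef₂ : ![ξm₂', ξl₂'] =
        (A₃.map ((↑) : ℚ → ℂ)).mulVec ![ξm₁, ξl₁]
          + (A₄.map ((↑) : ℚ → ℂ)).mulVec ![ξm₂, ξl₂])
    (p₁ q₁ r₁ s₁ p₂ q₂ r₂ s₂ : ℤ)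
    (hP₁ : p₁ * s₁ - q₁ * r₁ = 1) (hP₂ : p₂ * s₂ - q₂ * r₂ = 1)
    (p₁' q₁' p₂' q₂' : ℤ)
    (hD₁ : (p₁ : ℂ) * ξm₁ + (q₁ : ℂ) * ξl₁ = -(2 * (Real.pi : ℂ) * Complex.I))
    (hD₂ : (p₂ : ℂ) * ξm₂ + (q₂ : ℂ) * ξl₂ = -(2 * (Real.pi : ℂ) * Complex.I))
    (hD₁' : (p₁' : ℂ) * ξm₁' + (q₁' : ℂ) * ξl₁' = -(2 * (Real.pi : ℂ) * Complex.I))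
    (hD₂' : (p₂' : ℂ) * ξm₂' + (q₂' : ℂ) * ξl₂' = -(2 * (Real.pi : ℂ) * Complex.I))
    (t₁ t₂ : ℂ)
    (ht₁ : t₁ = Complex.exp ((r₁ : ℂ) * ξm₁ + (s₁ : ℂ) * ξl₁))
    (ht₂ : t₂ = Complex.exp ((r₂ : ℂ) * ξm₂ + (s₂ : ℂ) * ξl₂))
    (hind : ∀ a b : ℤ, t₁ ^ a * t₂ ^ b = 1 → a = 0 ∧ b = 0) :
    ∃ k₁ k₂ k₃ k₄ : ℚ,
      Matrix.vecMul ![(p₁' : ℚ), (q₁' : ℚ)] A₁ = k₁ • ![(p₁ : ℚ), (q₁ : ℚ)] ∧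
      Matrix.vecMul ![(p₁' : ℚ), (q₁' : ℚ)] A₂ = k₂ • ![(p₂ : ℚ), (q₂ : ℚ)] ∧
      Matrix.vecMul ![(p₂' : ℚ), (q₂' : ℚ)] A₃ = k₃ • ![(p₁ : ℚ), (q₁ : ℚ)] ∧
      Matrix.vecMul ![(p₂' : ℚ), (q₂' : ℚ)] A₄ = k₄ • ![(p₂ : ℚ), (q₂ : ℚ)] ∧
      k₁ + k₂ = 1 ∧ k₃ + k₄ = 1 := by
  subst ht₁ ht₂
  obtain ⟨k₁, k₂, h₁, h₂, h₁₂⟩ := exists_weights_of_dehn_row A₁ A₂ ξm₁ ξl₁ ξm₂ ξl₂ ξm₁' ξl₁' hdef₁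
    p₁ q₁ r₁ s₁ p₂ q₂ r₂ s₂ hP₁ hP₂ p₁' q₁' hD₁ hD₂ hD₁' hind
  obtain ⟨k₃, k₄, h₃, h₄, h₃₄⟩ := exists_weights_of_dehn_row A₃ A₄ ξm₁ ξl₁ ξm₂ ξl₂ ξm₂' ξl₂' hdef₂
    p₁ q₁ r₁ s₁ p₂ q₂ r₂ s₂ hP₁ hP₂ p₂' q₂' hD₁ hD₂ hD₂' hind
  exact ⟨k₁, k₂, k₃, k₄, h₁, h₂, h₃, h₄, h₁₂, h₃₄⟩
end

section
/- Let A₁, A₂, A₃, A₄ be 2×2 rational matrices. Let ξm₁, ξl₁, ξm₂, ξl₂ be complex numbers and define (ξm₁′, ξl₁′)ᵀ = A₁·(ξm₁, ξl₁)ᵀ + A₂·(ξm₂, ξl₂)ᵀ and (ξm₂′, ξl₂′)ᵀ = A₃·(ξm₁, ξl₁)ᵀ + A₄·(ξm₂, ξl₂)ᵀ. Let p_h, q_h, r_h, s_h and p_h′, q_h′, r_h′, s_h′ (h = 1, 2) be integers with p_h s_h − q_h r_h = p_h′ s_h′ − q_h′ r_h′ = 1, write P_h = [[p_h, q_h],[r_h,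 s_h]] and P_h′ = [[p_h′, q_h′],[r_h′, s_h′]], and suppose p_hξm_h + q_hξl_h = p_h′ξm_h′ + q_h′ξl_h′ = −2π√−1 for h = 1, 2. Set t_h = exp(r_hξm_h + s_hξl_h) and t_h′ = exp(r_h′ξm_h′ + s_h′ξl_h′). Assume t₁ and t₂ are multiplicatively independent and t₁t₂ = t₁′t₂′. Then there exist rational numbers k_j, l_j, n_j (1 ≤ j ≤ 4) such that P₁′·A₁ = [[k₁, 0],[n₁, l₁]]·P₁, P₁′·A₂ = [[k₂, 0],[n₂, l₂]]·P₂, P₂′·A₃ = [[k₃, 0],[n₃, l₃]]·P₁, P₂′·A₄ = [[k₄, 0],[n₄, l₄]]·P₂, with k₁ + k₂ = k₃ + k₄ = 1, l₁ + l₃ = l₂ + l₄ = 1, and k_j·l_j = det A_j for each j. -/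
open Matrix

/-- Logarithms of two multiplicatively independent numbers are linearly independent of
`2πi` over `ℚ`. -/
lemma rat_linearIndependent_of_exp_independent {u v : ℂ}
    (hind : ∀ a b : ℤ, Complex.exp u ^ a * Complex.exp v ^ b = 1 → a = 0 ∧ b = 0)
    {a b c : ℚ} (h : (a : ℂ) * u + b * v + c * (2 * (Real.pi : ℂ) * Complex.I) = 0) :
    a = 0 ∧ b = 0 ∧ c = 0 := by
  have hfrac (x : ℚ) : (x : ℂ) * x.den = x.num := by exact_mod_cast Rat.mul_den_eq_num x
  obtain ⟨ha, hb⟩ := hind (a.num * b.den * c.den) (b.num * a.den * c.den) <| by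
    rw [← Complex.exp_int_mul, ← Complex.exp_int_mul, ← Complex.exp_add, Complex.exp_eq_one_iff]
    refine ⟨-(c.num * a.den * b.den), ?_⟩
    push_cast
    linear_combination (a.den * b.den * c.den : ℂ) * h - (b.den * c.den * u) * hfrac a
      - (a.den * c.den * v) * hfrac b - (a.den * b.den * (2 * Real.pi * Complex.I)) * hfrac c
  have ha : a = 0 := by simpa using ha
  have hb : b = 0 := by simpa using hb
  refine ⟨ha, hb, ?_⟩
  simpa [ha, hb, Complex.two_pi_I_ne_zero] using h

/-- Change of coordinates in a sum of two rational linear maps of the plane. -/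
lemma map_mulVec_change_coordinates (A B P Q R : Matrix (Fin 2) (Fin 2) ℚ)
    (hP : P.det = 1) (hQ : Q.det = 1) (x y : Fin 2 → ℂ) :
    (R.map ((↑) : ℚ → ℂ)).mulVec
        ((A.map ((↑) : ℚ → ℂ)).mulVec x + (B.map ((↑) : ℚ → ℂ)).mulVec y)
      = ((R * A * P.adjugate).map ((↑) : ℚ → ℂ)).mulVec ((P.map ((↑) : ℚ → ℂ)).mulVec x)
        + ((R * B * Q.adjugate).map ((↑) : ℚ → ℂ)).mulVec
          ((Q.map ((↑) : ℚ → ℂ)).mulVec y) := by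
  have hmul (M N : Matrix (Fin 2) (Fin 2) ℚ) :
      M.map ((↑) : ℚ → ℂ) * N.map ((↑) : ℚ → ℂ) = (M * N).map ((↑) : ℚ → ℂ) :=
    (Matrix.map_mul (f := Rat.castHom ℂ)).symm
  simp only [mulVec_add, mulVec_mulVec, hmul, Matrix.mul_assoc, adjugate_mul, hP, hQ, one_smul,
    Matrix.mul_one]

/-- If `R A P⁻¹` is lower triangular with `P, R` unimodular, then it factors `R A` through `P`,
and its diagonal entries multiply to `det A`. -/
lemma mul_eq_lowerTriangular_mul (A P R : Matrix (Fin 2) (Fin 2) ℚ)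
    (hP : P.det = 1) (hR : R.det = 1) (h : (R * A * P.adjugate) 0 1 = 0) :
    R * A = !![(R * A * P.adjugate) 0 0, 0; (R * A * P.adjugate) 1 0,
        (R * A * P.adjugate) 1 1] * P ∧
      (R * A * P.adjugate) 0 0 * (R * A * P.adjugate) 1 1 = A.det := by
  constructor
  · rw [← h, ← eta_fin_two, Matrix.mul_assoc _ _ P, adjugate_mul, hP, one_smul, Matrix.mul_one]
  · have hdet : (R * A * P.adjugate).det = A.det := by
      simp [det_mul, det_adjugate, hP, hR]
    rw [det_fin_two, h] at hdet
    simpa using hdet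

/-- The vector of logarithmic holonomies of the curves given by the rows of an integer matrix. -/
lemma map_mulVec_eq_of_rows {p q r s : ℤ} {x y w : ℂ} (h : (p : ℂ) * x + q * y = w) :
    ((!![(p : ℚ), (q : ℚ); (r : ℚ), (s : ℚ)]).map ((↑) : ℚ → ℂ)).mulVec ![x, y]
      = ![w, (r : ℂ) * x + s * y] := by
  ext i
  fin_cases i <;> simp [← h, mulVec, dotProduct, Fin.sum_univ_two]

/-- Coordinate form of part (1) of Theorem 7.1 (Theorem 22031403) of the paper:
if the block matrix `[[A₁, A₂],[A₃, A₄]]` transforms a Dehn filling point with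
coefficients `(p₁/q₁, p₂/q₂)` into one with coefficients `(p₁'/q₁', p₂'/q₂')`, the
core holonomies `t₁, t₂` are multiplicatively independent and `t₁t₂ = t₁'t₂'`
(equality of pseudo complex volumes), then there exist rationals `kⱼ, lⱼ, nⱼ`
relating the coefficient matrices, with `k₁ + k₂ = k₃ + k₄ = 1`,
`l₁ + l₃ = l₂ + l₄ = 1` and `kⱼ·lⱼ = det Aⱼ`. -/
theorem block_matrix_dehn_transformation_full_relations
    (A₁ A₂ A₃ A₄ : Matrix (Fin 2) (Fin 2) ℚ)
    (ξm₁ ξl₁ ξm₂ ξl₂ ξm₁' ξl₁' ξm₂' ξl₂' : ℂ)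
    (hdef₁ : ![ξm₁', ξl₁'] =
        (A₁.map ((↑) : ℚ → ℂ)).mulVec ![ξm₁, ξl₁]
          + (A₂.map ((↑) : ℚ → ℂ)).mulVec ![ξm₂, ξl₂])
    (hdef₂ : ![ξm₂', ξl₂'] =
        (A₃.map ((↑) : ℚ → ℂ)).mulVec ![ξm₁, ξl₁]
          + (A₄.map ((↑) : ℚ → ℂ)).mulVec ![ξm₂, ξl₂])
    (p₁ q₁ r₁ s₁ p₂ q₂ r₂ s₂ p₁' q₁' r₁' s₁' p₂' q₂' r₂' s₂' : ℤ)
    (hP₁ : p₁ * s₁ - q₁ * r₁ = 1) (hP₂ : p₂ * s₂ - q₂ * r₂ = 1)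
    (hP₁' : p₁' * s₁' - q₁' * r₁' = 1) (hP₂' : p₂' * s₂' - q₂' * r₂' = 1)
    (hD₁ : (p₁ : ℂ) * ξm₁ + (q₁ : ℂ) * ξl₁ = -(2 * (Real.pi : ℂ) * Complex.I))
    (hD₂ : (p₂ : ℂ) * ξm₂ + (q₂ : ℂ) * ξl₂ = -(2 * (Real.pi : ℂ) * Complex.I))
    (hD₁' : (p₁' : ℂ) * ξm₁' + (q₁' : ℂ) * ξl₁' = -(2 * (Real.pi : ℂ) * Complex.I))
    (hD₂' : (p₂' : ℂ) * ξm₂' + (q₂' : ℂ) * ξl₂' = -(2 * (Real.pi : ℂ) * Complex.I))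
    (t₁ t₂ t₁' t₂' : ℂ)
    (ht₁ : t₁ = Complex.exp ((r₁ : ℂ) * ξm₁ + (s₁ : ℂ) * ξl₁))
    (ht₂ : t₂ = Complex.exp ((r₂ : ℂ) * ξm₂ + (s₂ : ℂ) * ξl₂))
    (ht₁' : t₁' = Complex.exp ((r₁' : ℂ) * ξm₁' + (s₁' : ℂ) * ξl₁'))
    (ht₂' : t₂' = Complex.exp ((r₂' : ℂ) * ξm₂' + (s₂' : ℂ) * ξl₂'))
    (hind : ∀ a b : ℤ, t₁ ^ a * t₂ ^ b = 1 → a = 0 ∧ b = 0)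
    (hvol : t₁ * t₂ = t₁' * t₂') :
    ∃ k₁ k₂ k₃ k₄ l₁ l₂ l₃ l₄ n₁ n₂ n₃ n₄ : ℚ,
      !![(p₁' : ℚ), (q₁' : ℚ); (r₁' : ℚ), (s₁' : ℚ)] * A₁
        = !![k₁, 0; n₁, l₁] * !![(p₁ : ℚ), (q₁ : ℚ); (r₁ : ℚ), (s₁ : ℚ)] ∧
      !![(p₁' : ℚ), (q₁' : ℚ); (r₁' : ℚ), (s₁' : ℚ)] * A₂
        = !![k₂, 0; n₂, l₂] * !![(p₂ : ℚ), (q₂ : ℚ); (r₂ : ℚ), (s₂ : ℚ)] ∧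
      !![(p₂' : ℚ), (q₂' : ℚ); (r₂' : ℚ), (s₂' : ℚ)] * A₃
        = !![k₃, 0; n₃, l₃] * !![(p₁ : ℚ), (q₁ : ℚ); (r₁ : ℚ), (s₁ : ℚ)] ∧
      !![(p₂' : ℚ), (q₂' : ℚ); (r₂' : ℚ), (s₂' : ℚ)] * A₄
        = !![k₄, 0; n₄, l₄] * !![(p₂ : ℚ), (q₂ : ℚ); (r₂ : ℚ), (s₂ : ℚ)] ∧
      k₁ + k₂ = 1 ∧ k₃ + k₄ = 1 ∧ l₁ + l₃ = 1 ∧ l₂ + l₄ = 1 ∧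
      k₁ * l₁ = A₁.det ∧ k₂ * l₂ = A₂.det ∧ k₃ * l₃ = A₃.det ∧ k₄ * l₄ = A₄.det := by
  subst ht₁ ht₂ ht₁' ht₂'
  have hdet {p q r s : ℤ} (h : p * s - q * r = 1) :
      (!![(p : ℚ), (q : ℚ); (r : ℚ), (s : ℚ)]).det = 1 := by
    rw [det_fin_two_of]
    exact_mod_cast h
  have hrow₁ := map_mulVec_change_coordinates A₁ A₂ _ _
    !![(p₁' : ℚ), (q₁' : ℚ); (r₁' : ℚ), (s₁' : ℚ)]
    (hdet hP₁) (hdet hP₂) ![ξm₁, ξl₁] ![ξm₂, ξl₂]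
  have hrow₂ := map_mulVec_change_coordinates A₃ A₄ _ _
    !![(p₂' : ℚ), (q₂' : ℚ); (r₂' : ℚ), (s₂' : ℚ)]
    (hdet hP₁) (hdet hP₂) ![ξm₁, ξl₁] ![ξm₂, ξl₂]
  rw [← hdef₁, map_mulVec_eq_of_rows hD₁', map_mulVec_eq_of_rows hD₁,
    map_mulVec_eq_of_rows hD₂] at hrow₁
  rw [← hdef₂, map_mulVec_eq_of_rows hD₂', map_mulVec_eq_of_rows hD₁,
    map_mulVec_eq_of_rows hD₂] at hrow₂
  have fac₁ := mul_eq_lowerTriangular_mul A₁ _ _ (hdet hP₁) (hdet hP₁')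
  have fac₂ := mul_eq_lowerTriangular_mul A₂ _ _ (hdet hP₂) (hdet hP₁')
  have fac₃ := mul_eq_lowerTriangular_mul A₃ _ _ (hdet hP₁) (hdet hP₂')
  have fac₄ := mul_eq_lowerTriangular_mul A₄ _ _ (hdet hP₂) (hdet hP₂')
  generalize !![(p₁' : ℚ), (q₁' : ℚ); (r₁' : ℚ), (s₁' : ℚ)] * A₁ *
    (!![(p₁ : ℚ), (q₁ : ℚ); (r₁ : ℚ), (s₁ : ℚ)]).adjugate = M₁ at hrow₁ fac₁
  generalize !![(p₁' : ℚ), (q₁' : ℚ); (r₁' : ℚ), (s₁' : ℚ)] * A₂ *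
    (!![(p₂ : ℚ), (q₂ : ℚ); (r₂ : ℚ), (s₂ : ℚ)]).adjugate = M₂ at hrow₁ fac₂
  generalize !![(p₂' : ℚ), (q₂' : ℚ); (r₂' : ℚ), (s₂' : ℚ)] * A₃ *
    (!![(p₁ : ℚ), (q₁ : ℚ); (r₁ : ℚ), (s₁ : ℚ)]).adjugate = M₃ at hrow₂ fac₃
  generalize !![(p₂' : ℚ), (q₂' : ℚ); (r₂' : ℚ), (s₂' : ℚ)] * A₄ *
    (!![(p₂ : ℚ), (q₂ : ℚ); (r₂ : ℚ), (s₂ : ℚ)]).adjugate = M₄ at hrow₂ fac₄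
  have top₁ := congrFun hrow₁ 0
  have top₂ := congrFun hrow₂ 0
  have bot₁ := congrFun hrow₁ 1
  have bot₂ := congrFun hrow₂ 1
  simp only [Pi.add_apply, mulVec, dotProduct, Fin.sum_univ_two, map_apply, cons_val_zero,
    cons_val_one] at top₁ top₂ bot₁ bot₂
  rw [← Complex.exp_add, ← Complex.exp_add, Complex.exp_eq_exp_iff_exists_int] at hvol
  obtain ⟨k, hk⟩ := hvol
  rw [bot₁, bot₂] at hk
  obtain ⟨h₁, h₂, hk₁⟩ := rat_linearIndependent_of_exp_independent hind
    (a := M₁ 0 1) (b := M₂ 0 1) (c := 1 - M₁ 0 0 - M₂ 0 0) (by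
      push_cast
      linear_combination -top₁)
  obtain ⟨h₃, h₄, hk₃⟩ := rat_linearIndependent_of_exp_independent hind
    (a := M₃ 0 1) (b := M₄ 0 1) (c := 1 - M₃ 0 0 - M₄ 0 0) (by
      push_cast
      linear_combination -top₂)
  obtain ⟨hl₁, hl₂, -⟩ := rat_linearIndependent_of_exp_independent hind
    (a := M₁ 1 1 + M₃ 1 1 - 1) (b := M₂ 1 1 + M₄ 1 1 - 1)
    (c := k - M₁ 1 0 - M₂ 1 0 - M₃ 1 0 - M₄ 1 0) (by
      push_cast
      linear_combination -hk)
  exact ⟨_, _, _, _, _, _, _, _, _, _, _, _, (fac₁ h₁).1, (fac₂ h₂).1, (fac₃ h₃).1, (fac₄ h₄).1,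
    by linarith, by linarith, by linarith, by linarith,
    (fac₁ h₁).2, (fac₂ h₂).2, (fac₃ h₃).2, (fac₄ h₄).2⟩
end

section
/- Let p₁′, q₁′, r₁′, s₁′, p₂′, q₂′, r₂′, s₂′ be integers with p₁′s₁′ − q₁′r₁′ = p₂′s₂′ − q₂′r₂′ = 1, and let ξm₁′, ξl₁′, ξm₂′, ξl₂′ be complex numbers with p₁′ξm₁′ + q₁′ξl₁′ = p₂′ξm₂′ + q₂′ξl₂′ = −2π√−1. Assume t₁′ = exp(r₁′ξm₁′ + s₁′ξl₁′) and t₂′ = exp(r₂′ξm₂′ + s₂′ξl₂′) are multiplicatively independent. If integers a, b, c, d satisfy a·ξm₁′ + b·ξl₁′ + c·ξm₂′ + d·ξl₂′ = 0, then there exists k ∈ ℚ such that (a, b) = k·(p₁′, q₁′) and (c, d) = −k·(p₂′, q₂′). -/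
/-- Key intermediate claim in the proof of Lemma 8.2 (Lemma 22062503) of the paper:
any integral linear relation among the logarithmic coordinates of a Dehn filling
point whose core holonomies `t₁', t₂'` are multiplicatively independent is a
rational multiple of the difference of the two Dehn filling equations. -/
theorem linear_relation_among_dehn_point_coordinates
    (p₁' q₁' r₁' s₁' p₂' q₂' r₂' s₂' : ℤ)
    (hP₁' : p₁' * s₁' - q₁' * r₁' = 1) (hP₂' : p₂' * s₂' - q₂' * r₂' = 1)
    (ξm₁' ξl₁' ξm₂' ξl₂' : ℂ)
    (hD₁' : (p₁' : ℂ) * ξm₁' + (q₁' : ℂ) * ξl₁' = -(2 * (Real.pi : ℂ) * Complex.I))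
    (hD₂' : (p₂' : ℂ) * ξm₂' + (q₂' : ℂ) * ξl₂' = -(2 * (Real.pi : ℂ) * Complex.I))
    (t₁' t₂' : ℂ)
    (ht₁' : t₁' = Complex.exp ((r₁' : ℂ) * ξm₁' + (s₁' : ℂ) * ξl₁'))
    (ht₂' : t₂' = Complex.exp ((r₂' : ℂ) * ξm₂' + (s₂' : ℂ) * ξl₂'))
    (hind : ∀ a b : ℤ, t₁' ^ a * t₂' ^ b = 1 → a = 0 ∧ b = 0)
    (a b c d : ℤ)
    (hrel : (a : ℂ) * ξm₁' + (b : ℂ) * ξl₁' + (c : ℂ) * ξm₂' + (d : ℂ) * ξl₂' = 0) :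
    ∃ k : ℚ, (a : ℚ) = k * (p₁' : ℚ) ∧ (b : ℚ) = k * (q₁' : ℚ) ∧
      (c : ℚ) = -(k * (p₂' : ℚ)) ∧ (d : ℚ) = -(k * (q₂' : ℚ)) := by
  have hP₁c : (p₁' : ℂ) * s₁' - q₁' * r₁' = 1 := by exact_mod_cast hP₁'
  have hP₂c : (p₂' : ℂ) * s₂' - q₂' * r₂' = 1 := by exact_mod_cast hP₂'
  have hcore : ((b * p₁' - a * q₁' : ℤ) : ℂ) * (r₁' * ξm₁' + s₁' * ξl₁')
      + ((d * p₂' - c * q₂' : ℤ) : ℂ) * (r₂' * ξm₂' + s₂' * ξl₂')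
      = ((a * s₁' - b * r₁' + (c * s₂' - d * r₂') : ℤ) : ℂ) * (2 * Real.pi * Complex.I) := by
    push_cast
    linear_combination hrel + (a * ξm₁' + b * ξl₁') * hP₁c + (c * ξm₂' + d * ξl₂') * hP₂c
      - (a * s₁' - b * r₁') * hD₁' - (c * s₂' - d * r₂') * hD₂'
  obtain ⟨h₁, h₂⟩ : b * p₁' - a * q₁' = 0 ∧ d * p₂' - c * q₂' = 0 := by
    apply hind
    rw [ht₁', ht₂', ← Complex.exp_int_mul, ← Complex.exp_int_mul, ← Complex.exp_add, hcore]
    exact Complex.exp_int_mul_two_pi_mul_I _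
  have hsum : a * s₁' - b * r₁' + (c * s₂' - d * r₂') = 0 := by
    rw [h₁, h₂, Int.cast_zero, zero_mul, zero_mul, add_zero, eq_comm, mul_eq_zero] at hcore
    exact_mod_cast hcore.resolve_right Complex.two_pi_I_ne_zero
  refine ⟨((a * s₁' - b * r₁' : ℤ) : ℚ), ?_, ?_, ?_, ?_⟩ <;> norm_cast
  · linear_combination -a * hP₁' + r₁' * h₁
  · linear_combination -b * hP₁' + s₁' * h₁
  · linear_combination -c * hP₂' + r₂' * h₂ + p₂' * hsum
  · linear_combination -d * hP₂' + s₂' * h₂ + q₂' * hsum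
end

section
/- Let τ be a non-real complex number, let a, b, c, d be rational numbers with ad − bc = 1 and b ≠ 0, and let α ≥ 3 be an integer such that τ(a + bτ) = c + dτ and (a + bτ)^α = d − bτ. Then (a + bτ)^{α+1} = 1; the number a + bτ is a primitive n-th root of unity for some n ∈ {3, 4, 6} with n dividing α + 1; explicitly a + bτ ∈ {ω, ω², −ω, −ω², √−1, −√−1}, where ω = (1 + √−3)/2; moreover d − bτ = (a + bτ)⁻¹, a + d ∈ {−1, 0, 1}, and τ lies in ℚ(√−3) (i.e. τ = x + y√−3 with x, y ∈ ℚ) when a + bτ ∈ {ω, ω², −ω, −ω²}, while τ lies in ℚ(√−1) (i.e. τ = x + y√−1 with x, y ∈ ℚ) when a + bτ = ±√−1. -/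
/-- The primitive sixth root of unity `ω = (1 + √-3)/2`. -/
noncomputable def omegaRoot : ℂ := (1 + Real.sqrt 3 * Complex.I) / 2

theorem omegaRoot_sq : omegaRoot ^ 2 = (-1 + Real.sqrt 3 * Complex.I) / 2 := by
  have h3 : ((Real.sqrt 3 : ℝ) : ℂ) ^ 2 = 3 := by
    rw [← Complex.ofReal_pow, Real.sq_sqrt (by norm_num)]; norm_num
  unfold omegaRoot
  linear_combination (1 / 4 * Complex.I ^ 2) * h3 + 3 / 4 * Complex.I_sq

theorem omegaRoot_sq_eq_sub_one : omegaRoot ^ 2 = omegaRoot - 1 := by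
  rw [omegaRoot_sq]
  unfold omegaRoot
  ring

theorem sq_sub_self_add_one_eq_zero_iff (z : ℂ) :
    z ^ 2 - z + 1 = 0 ↔ z = omegaRoot ∨ z = -(omegaRoot ^ 2) := by
  have h : z ^ 2 - z + 1 = (z - omegaRoot) * (z - -(omegaRoot ^ 2)) := by
    linear_combination (1 + omegaRoot - z) * omegaRoot_sq_eq_sub_one
  rw [h, mul_eq_zero, sub_eq_zero, sub_eq_zero]

theorem sq_add_self_add_one_eq_zero_iff (z : ℂ) :
    z ^ 2 + z + 1 = 0 ↔ z = omegaRoot ^ 2 ∨ z = -omegaRoot := by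
  have h := sq_sub_self_add_one_eq_zero_iff (-z)
  rw [neg_sq, sub_neg_eq_add, neg_inj] at h
  rw [h, or_comm, neg_eq_iff_eq_neg]

/-- A non-real complex root of `X² - tX + 1` has norm one, so its trace `t` satisfies
`|t| < 2`. -/
theorem abs_lt_two_of_sq_sub_mul_add_one_eq_zero {z : ℂ} (hz : z.im ≠ 0) {t : ℝ}
    (h : z ^ 2 - t * z + 1 = 0) : |t| < 2 := by
  have hre := congrArg Complex.re h
  have him := congrArg Complex.im h
  simp [pow_two] at hre him
  have ht : t = 2 * z.re := by
    apply mul_right_cancel₀ hz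
    linarith
  subst ht
  have hy : 0 < z.im ^ 2 := by positivity
  rw [abs_lt]
  constructor <;> nlinarith

/-- If a rational number is a sum of two complex algebraic integers, it is an integer. -/
theorem exists_int_of_isIntegral_add {z w : ℂ} (hz : IsIntegral ℤ z) (hw : IsIntegral ℤ w)
    {t : ℚ} (h : z + w = t) : ∃ m : ℤ, t = m := by
  have ht : IsIntegral ℤ (algebraMap ℚ ℂ t) := by
    rw [eq_ratCast, ← h]
    exact hz.add hw
  rw [isIntegral_algebraMap_iff (algebraMap ℚ ℂ).injective] at ht
  obtain ⟨m, hm⟩ := IsIntegrallyClosed.isIntegral_iff.mp ht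
  exact ⟨m, by simpa using hm.symm⟩

theorem exists_rat_add_mul_of_affine_eq {τ s : ℂ} {a b p q : ℚ} (hb : b ≠ 0)
    (h : (a : ℂ) + b * τ = p + q * s) : ∃ x y : ℚ, τ = (x : ℂ) + (y : ℂ) * s := by
  have hb' : (b : ℂ) ≠ 0 := by exact_mod_cast hb
  refine ⟨(p - a) / b, q / b, ?_⟩
  push_cast
  field_simp
  linear_combination h

theorem isPrimitiveRoot_three_of_sq_add_self_add_one {z : ℂ} (h : z ^ 2 + z + 1 = 0) :
    IsPrimitiveRoot z 3 := by
  rw [← Polynomial.isRoot_cyclotomic_iff, Polynomial.cyclotomic_three]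
  simpa using h

theorem isPrimitiveRoot_six_of_sq_sub_self_add_one {z : ℂ} (h : z ^ 2 - z + 1 = 0) :
    IsPrimitiveRoot z 6 := by
  rw [← Polynomial.isRoot_cyclotomic_iff, Polynomial.cyclotomic_six]
  simpa using h

theorem isPrimitiveRoot_four_of_sq_eq_neg_one {z : ℂ} (h : z ^ 2 = -1) :
    IsPrimitiveRoot z 4 := by
  have : IsPrimitiveRoot z (2 ^ (1 + 1)) := by
    rw [IsPrimitiveRoot.iff_orderOf]
    apply orderOf_eq_prime_pow
    · rw [pow_one, h]; norm_num
    · rw [show (2 : ℕ) ^ (1 + 1) = 2 * 2 by norm_num, pow_mul, h]; norm_num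
  simpa using this

/-- Computational content of Lemma 4.2 (Lemma 20101702) of the paper:
if the cusp shape `τ` of a 1-cusped hyperbolic 3-manifold satisfies
`τ(a + bτ) = c + dτ` and `(a + bτ)^α = d − bτ` with `ad − bc = 1`, `b ≠ 0`,
then `a + bτ` is a primitive `n`-th root of unity for some `n ∈ {3, 4, 6}` dividing
`α + 1`, explicitly one of `ω, ω², −ω, −ω², √-1, −√-1`, with `d − bτ = (a + bτ)⁻¹`,
`a + d ∈ {−1, 0, 1}`, and `τ` lies in `ℚ(√-3)` resp. `ℚ(√-1)` accordingly. -/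
theorem cusp_shape_quadratic_of_nontrivial_anomalous_subvariety
    (τ : ℂ) (hτ : τ.im ≠ 0)
    (a b c d : ℚ) (hdet : a * d - b * c = 1) (hb : b ≠ 0)
    (α : ℕ) (hα : 3 ≤ α)
    (h1 : τ * ((a : ℂ) + (b : ℂ) * τ) = (c : ℂ) + (d : ℂ) * τ)
    (h2 : ((a : ℂ) + (b : ℂ) * τ) ^ α = (d : ℂ) - (b : ℂ) * τ) :
    ((a : ℂ) + (b : ℂ) * τ) ^ (α + 1) = 1 ∧
    (∃ n ∈ ({3, 4, 6} : Set ℕ),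
        IsPrimitiveRoot ((a : ℂ) + (b : ℂ) * τ) n ∧ n ∣ (α + 1)) ∧
    ((a : ℂ) + (b : ℂ) * τ) ∈
      ({omegaRoot, omegaRoot ^ 2, -omegaRoot, -(omegaRoot ^ 2),
        Complex.I, -Complex.I} : Set ℂ) ∧
    (d : ℂ) - (b : ℂ) * τ = ((a : ℂ) + (b : ℂ) * τ)⁻¹ ∧
    a + d ∈ ({-1, 0, 1} : Set ℚ) ∧
    (((a : ℂ) + (b : ℂ) * τ ∈
        ({omegaRoot, omegaRoot ^ 2, -omegaRoot, -(omegaRoot ^ 2)} : Set ℂ)) →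
      ∃ x y : ℚ, τ = (x : ℂ) + (y : ℂ) * (Real.sqrt 3 * Complex.I)) ∧
    (((a : ℂ) + (b : ℂ) * τ = Complex.I ∨ (a : ℂ) + (b : ℂ) * τ = -Complex.I) →
      ∃ x y : ℚ, τ = (x : ℂ) + (y : ℂ) * Complex.I) := by
  have hmul : ((a : ℂ) + b * τ) * (d - b * τ) = 1 := by
    have hdet' : (a : ℂ) * d - b * c = 1 := by exact_mod_cast hdet
    linear_combination hdet' - b * h1
  have him : ((a : ℂ) + b * τ).im ≠ 0 := by
    simpa using And.intro hb hτ
  have hsum : ((a : ℂ) + b * τ) + (d - b * τ) = ((a + d : ℚ) : ℂ) := by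
    push_cast
    ring
  have hlin (s : ℂ) (p q : ℚ) := exists_rat_add_mul_of_affine_eq (τ := τ) (s := s) (a := a)
    (p := p) (q := q) hb
  generalize (a : ℂ) + b * τ = z at *
  generalize (d : ℂ) - b * τ = w at *
  generalize a + d = t at *
  have hpow : z ^ (α + 1) = 1 := by rw [pow_succ, h2, mul_comm, hmul]
  have hint : IsIntegral ℤ z := .of_pow α.succ_pos (hpow ▸ isIntegral_one)
  have hquad : z ^ 2 - t * z + 1 = 0 := by linear_combination z * hsum - hmul
  have ht : t = -1 ∨ t = 0 ∨ t = 1 := by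
    obtain ⟨m, rfl⟩ := exists_int_of_isIntegral_add hint (h2 ▸ hint.pow α) hsum
    have hlt := abs_lt_two_of_sq_sub_mul_add_one_eq_zero (t := m) him (by simpa using hquad)
    have hm : |m| < 2 := by exact_mod_cast hlt
    rw [abs_lt] at hm
    have hm' : m = -1 ∨ m = 0 ∨ m = 1 := by omega
    exact_mod_cast hm'
  refine ⟨hpow, ?_, ?_, eq_inv_of_mul_eq_one_right hmul, by simpa using ht, ?_, ?_⟩
  · rcases ht with rfl | rfl | rfl
    · have h := isPrimitiveRoot_three_of_sq_add_self_add_one (z := z) (by simpa using hquad)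
      exact ⟨3, by simp, h, h.dvd_of_pow_eq_one _ hpow⟩
    · have h := isPrimitiveRoot_four_of_sq_eq_neg_one (z := z)
        (eq_neg_of_add_eq_zero_left (by simpa using hquad))
      exact ⟨4, by simp, h, h.dvd_of_pow_eq_one _ hpow⟩
    · have h := isPrimitiveRoot_six_of_sq_sub_self_add_one (z := z) (by simpa using hquad)
      exact ⟨6, by simp, h, h.dvd_of_pow_eq_one _ hpow⟩
  · rcases ht with rfl | rfl | rfl
    · rcases (sq_add_self_add_one_eq_zero_iff z).mp (by simpa using hquad) with h | h <;> simp [h]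
    · have h : z ^ 2 = Complex.I ^ 2 := by
        rw [Complex.I_sq]
        exact eq_neg_of_add_eq_zero_left (by simpa using hquad)
      rcases sq_eq_sq_iff_eq_or_eq_neg.mp h with h | h <;> simp [h]
    · rcases (sq_sub_self_add_one_eq_zero_iff z).mp (by simpa using hquad) with h | h <;> simp [h]
  · rintro (h | h | h | h)
    · exact hlin _ (1 / 2) (1 / 2) (by rw [h, omegaRoot]; push_cast; ring)
    · exact hlin _ (-1 / 2) (1 / 2) (by rw [h, omegaRoot_sq]; push_cast; ring)
    · exact hlin _ (-1 / 2) (-1 / 2) (by rw [h, omegaRoot]; push_cast; ring)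
    · exact hlin _ (1 / 2) (-1 / 2) (by rw [h, omegaRoot_sq]; push_cast; ring)
  · rintro (h | h)
    · exact hlin _ 0 1 (by rw [h]; push_cast; ring)
    · exact hlin _ 0 (-1) (by rw [h]; push_cast; ring)
end

section
/- Let τ be a non-real complex number, let a, b, c, d be rational numbers with ad − bc = 1 and b ≠ 0, and let α ≥ 3 be an integer such that τ(a + bτ) = c + dτ and (a + bτ)^α = d − bτ. Put σ = [[a, b],[c, d]]. Then a + d ∈ {−1, 0, 1}, and: if a + d = 1 then σ³ = −I (so σ has order 6); if a + d = −1 then σ³ = I; if a + d = 0 then σ² = −I (so σ has order 4). In particular, if τ ∈ ℚ(√−3) then σ⁶ = I, and if τ ∈ ℚ(√−1) then σ⁴ = I. -/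
/-- A rational number whose image in `ℂ` is integral over `ℤ` is an integer. -/
theorem exists_int_eq_of_isIntegral_ratCast {t : ℚ} (ht : IsIntegral ℤ (t : ℂ)) :
    ∃ n : ℤ, (n : ℚ) = t := by
  have h : IsIntegral ℤ (algebraMap ℚ ℂ t) := by simpa using ht
  have h' : IsIntegral ℤ t := (isIntegral_algebraMap_iff (algebraMap ℚ ℂ).injective).1 h
  obtain ⟨n, hn⟩ := IsIntegrallyClosed.isIntegral_iff.1 h'
  exact ⟨n, by simpa using hn⟩

/-- A non-real root of `X ^ 2 - t X + 1` with `t` real has real part `t / 2`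
and lies on the unit circle. -/
theorem Complex.re_im_of_quadratic_root {z : ℂ} {t : ℝ} (hz : z.im ≠ 0)
    (h : z ^ 2 - t * z + 1 = 0) : t = 2 * z.re ∧ z.re ^ 2 + z.im ^ 2 = 1 := by
  have hre := congrArg Complex.re h
  have him := congrArg Complex.im h
  simp [pow_two] at hre him
  have ht : t = 2 * z.re := by
    apply mul_right_cancel₀ hz
    linarith
  subst ht
  exact ⟨rfl, by linarith⟩

theorem Matrix.sq_fin_two_of_det_eq_one {R : Type*} [CommRing R] {a b c d : R}
    (hdet : a * d - b * c = 1) :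
    (!![a, b; c, d] : Matrix (Fin 2) (Fin 2) R) ^ 2 = (a + d) • !![a, b; c, d] - 1 := by
  rw [pow_two, Matrix.one_fin_two]
  ext i j
  fin_cases i <;> fin_cases j <;> simp
  · linear_combination -hdet
  · ring
  · ring
  · linear_combination -hdet

theorem pow_three_eq_neg_one_of_sq_eq_sub_one {R : Type*} [Ring R] {x : R}
    (h : x ^ 2 = x - 1) : x ^ 3 = -1 := by
  rw [pow_succ, h, sub_mul, ← pow_two, h]
  noncomm_ring

theorem pow_three_eq_one_of_sq_eq_neg_sub_one {R : Type*} [Ring R] {x : R}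
    (h : x ^ 2 = -x - 1) : x ^ 3 = 1 := by
  rw [pow_succ, h, sub_mul, neg_mul, ← pow_two, h]
  noncomm_ring

theorem orderOf_eq_six_of_pow_three_eq_neg_one {R : Type*} [Ring R] {x : R}
    (h : x ^ 3 = -1) (hx : x ^ 2 ≠ 1) (hR : (-1 : R) ≠ 1) : orderOf x = 6 := by
  have h6 : x ^ 6 = 1 := by rw [show 6 = 3 * 2 from rfl, pow_mul, h]; simp
  refine orderOf_eq_of_pow_and_pow_div_prime (by norm_num) h6 fun p hp hdvd => ?_
  rcases (hp.dvd_mul (m := 2) (n := 3)).1 hdvd with h2 | h3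
  · rw [(Nat.prime_dvd_prime_iff_eq hp Nat.prime_two).1 h2]
    simpa [h] using hR
  · rw [(Nat.prime_dvd_prime_iff_eq hp Nat.prime_three).1 h3]
    simpa using hx

theorem orderOf_eq_four_of_sq_eq_neg_one {R : Type*} [Ring R] {x : R}
    (h : x ^ 2 = -1) (hR : (-1 : R) ≠ 1) : orderOf x = 4 := by
  have h4 : x ^ (2 ^ (1 + 1)) = 1 := by
    rw [show 2 ^ (1 + 1) = 2 * 2 from rfl, pow_mul, h]; simp
  exact orderOf_eq_prime_pow (p := 2) (n := 1) (by simpa [h] using hR) h4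

theorem Rat.sq_ne_three (q : ℚ) : q ^ 2 ≠ 3 := by
  intro h
  have hirr : Irrational (√(3 : ℝ)) := by
    simpa using (Nat.Prime.irrational_sqrt Nat.prime_three)
  refine hirr ⟨|q|, ?_⟩
  have hq : (q : ℝ) ^ 2 = 3 := by exact_mod_cast h
  rw [← hq, Real.sqrt_sq_eq_abs]
  push_cast
  rfl

/-- Lemma 4.3 (Lemma 20102501) of the paper in coordinate form:
under the hypotheses of Lemma 20101702, the matrix `σ = [[a, b],[c, d]]` relating
the two Dehn filling coefficients satisfies: `a + d ∈ {−1, 0, 1}`; if `a + d = 1`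
then `σ³ = −I` (so `σ` has order 6); if `a + d = −1` then `σ³ = I`; if `a + d = 0`
then `σ² = −I` (so `σ` has order 4). In particular, `σ⁶ = I` when `τ ∈ ℚ(√-3)` and
`σ⁴ = I` when `τ ∈ ℚ(√-1)`. -/
theorem order_of_matrix_relating_dehn_coefficients
    (τ : ℂ) (hτ : τ.im ≠ 0)
    (a b c d : ℚ) (hdet : a * d - b * c = 1) (hb : b ≠ 0)
    (α : ℕ) (hα : 3 ≤ α)
    (h1 : τ * ((a : ℂ) + (b : ℂ) * τ) = (c : ℂ) + (d : ℂ) * τ)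
    (h2 : ((a : ℂ) + (b : ℂ) * τ) ^ α = (d : ℂ) - (b : ℂ) * τ) :
    a + d ∈ ({-1, 0, 1} : Set ℚ) ∧
    (a + d = 1 →
      (!![a, b; c, d] : Matrix (Fin 2) (Fin 2) ℚ) ^ 3 = -1 ∧
      orderOf (!![a, b; c, d] : Matrix (Fin 2) (Fin 2) ℚ) = 6) ∧
    (a + d = -1 → (!![a, b; c, d] : Matrix (Fin 2) (Fin 2) ℚ) ^ 3 = 1) ∧
    (a + d = 0 →
      (!![a, b; c, d] : Matrix (Fin 2) (Fin 2) ℚ) ^ 2 = -1 ∧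
      orderOf (!![a, b; c, d] : Matrix (Fin 2) (Fin 2) ℚ) = 4) ∧
    ((∃ x y : ℚ, τ = (x : ℂ) + (y : ℂ) * (Real.sqrt 3 * Complex.I)) →
      (!![a, b; c, d] : Matrix (Fin 2) (Fin 2) ℚ) ^ 6 = 1) ∧
    ((∃ x y : ℚ, τ = (x : ℂ) + (y : ℂ) * Complex.I) →
      (!![a, b; c, d] : Matrix (Fin 2) (Fin 2) ℚ) ^ 4 = 1) := by
  set z : ℂ := (a : ℂ) + (b : ℂ) * τ with hz
  set σ : Matrix (Fin 2) (Fin 2) ℚ := !![a, b; c, d] with hσ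
  have hdetC : (a : ℂ) * d - b * c = 1 := by exact_mod_cast hdet
  have him : z.im = b * τ.im := by simp [hz]
  have hz0 : z.im ≠ 0 := by
    rw [him]
    exact mul_ne_zero (by exact_mod_cast hb) hτ
  have hprod : z * (d - b * τ) = 1 := by
    linear_combination hdetC - (b : ℂ) * h1 + (b : ℂ) * τ * hz
  have hquad : z ^ 2 - (((a + d : ℚ) : ℝ) : ℂ) * z + 1 = 0 := by
    push_cast
    linear_combination -hprod + z * hz
  obtain ⟨hre, hnorm⟩ := Complex.re_im_of_quadratic_root hz0 hquad
  have hone : z ^ (α + 1) = 1 := by rw [pow_succ, h2, mul_comm, hprod]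
  have hint : IsIntegral ℤ z :=
    IsIntegral.of_pow (Nat.succ_pos α) (by rw [hone]; exact isIntegral_one)
  have htr : ((a + d : ℚ) : ℂ) = z + z ^ α := by
    rw [h2, hz]
    push_cast
    ring
  obtain ⟨n, hn⟩ := exists_int_eq_of_isIntegral_ratCast (htr ▸ hint.add (hint.pow α))
  have hdisc : ((a + d : ℚ) : ℝ) ^ 2 + 4 * (b * τ.im) ^ 2 = 4 := by
    rw [hre, ← him]
    linear_combination 4 * hnorm
  have hlt : n ^ 2 < 4 := by
    have hpos : 0 < (b * τ.im) ^ 2 := by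
      rw [← him]
      positivity
    have h : ((a + d : ℚ) : ℝ) ^ 2 < 4 := by linarith
    rw [← hn] at h
    exact_mod_cast h
  have hcases : a + d = -1 ∨ a + d = 0 ∨ a + d = 1 := by
    have hlo : -2 < n := by nlinarith
    have hhi : n < 2 := by nlinarith
    rw [← hn]
    interval_cases n <;> simp
  have hsq : σ ^ 2 = (a + d) • σ - 1 := Matrix.sq_fin_two_of_det_eq_one hdet
  have hneg : (-1 : Matrix (Fin 2) (Fin 2) ℚ) ≠ 1 := by
    intro h
    have h00 := congrFun (congrFun h 0) 0
    norm_num at h00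
  have hpos : a + d = 1 → σ ^ 3 = -1 := fun h =>
    pow_three_eq_neg_one_of_sq_eq_sub_one (by rw [hsq, h, one_smul])
  have hnegOne : a + d = -1 → σ ^ 3 = 1 := fun h =>
    pow_three_eq_one_of_sq_eq_neg_sub_one (by rw [hsq, h, neg_one_smul])
  have hzero : a + d = 0 → σ ^ 2 = -1 := fun h => by rw [hsq, h, zero_smul, zero_sub]
  refine ⟨by simpa using hcases, fun h => ⟨hpos h, ?_⟩, hnegOne,
    fun h => ⟨hzero h, orderOf_eq_four_of_sq_eq_neg_one (hzero h) hneg⟩, ?_, ?_⟩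
  · refine orderOf_eq_six_of_pow_three_eq_neg_one (hpos h) (fun h' => hb ?_) hneg
    rw [hsq, h, one_smul] at h'
    simpa [hσ] using congrFun (congrFun h' 0) 1
  · rintro ⟨x, y, hxy⟩
    have hτim : τ.im = y * √3 := by simp [hxy]
    have h3 : (√3 : ℝ) ^ 2 = 3 := Real.sq_sqrt (by norm_num)
    have hrat : (a + d) ^ 2 + 12 * (b * y) ^ 2 = 4 := by
      rw [hτim] at hdisc
      have h : ((a + d : ℚ) : ℝ) ^ 2 + 12 * ((b : ℝ) * y) ^ 2 = 4 := by
        linear_combination hdisc - 4 * ((b : ℝ) * y) ^ 2 * h3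
      exact_mod_cast h
    rw [show 6 = 3 * 2 from rfl, pow_mul]
    rcases hcases with h | h | h
    · rw [hnegOne h, one_pow]
    · refine absurd ?_ (Rat.sq_ne_three (3 * (b * y)))
      rw [h] at hrat
      linarith
    · rw [hpos h, neg_one_sq]
  · rintro ⟨x, y, hxy⟩
    have hτim : τ.im = y := by simp [hxy]
    have hrat : (a + d) ^ 2 + 4 * (b * y) ^ 2 = 4 := by
      rw [hτim] at hdisc
      exact_mod_cast hdisc
    rcases hcases with h | h | h
    · refine absurd ?_ (Rat.sq_ne_three (2 * (b * y)))
      rw [h] at hrat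
      linarith
    · rw [show 4 = 2 * 2 from rfl, pow_mul, hzero h, neg_one_sq]
    · refine absurd ?_ (Rat.sq_ne_three (2 * (b * y)))
      rw [h] at hrat
      linarith
end

section
/- Let τ₁ and τ₂ be non-real complex algebraic numbers that are relatively independent, meaning there exist no integers a, b, c, d with cτ₂ + d ≠ 0 and τ₁ = (aτ₂ + b)/(cτ₂ + d). Let A₁ and A₂ be 2×2 rational matrices with det A₁ ≠ 0. If the vectors A₁·(1, τ₁)ᵀ and A₂·(1, τ₂)ᵀ in ℂ² are parallel (their 2×2 determinant vanishes), then A₂ is the zero matrix. -/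
open Matrix

/-- A rational affine relation satisfied by a non-real complex number is trivial. -/
lemma Complex.ratCast_mul_add_ratCast_eq_zero {τ : ℂ} (hτ : τ.im ≠ 0) {x y : ℚ}
    (h : (x : ℂ) * τ + y = 0) : x = 0 ∧ y = 0 := by
  have hx : x = 0 := by simpa [hτ] using congrArg Complex.im h
  subst hx
  exact ⟨rfl, by simpa using h⟩

/-- The coefficients of a rational fractional linear transformation can be taken integral. -/
lemma exists_int_fractional_linear_of_rat {K : Type*} [Field K] [CharZero K] {σ τ : K}
    {a b c d : ℚ} (hne : (c : K) * τ + d ≠ 0) (h : σ * (c * τ + d) = a * τ + b) :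
    ∃ a' b' c' d' : ℤ, (c' : K) * τ + d' ≠ 0 ∧ σ = (a' * τ + b') / (c' * τ + d') := by
  obtain ⟨n, hn⟩ := IsLocalization.exist_integer_multiples_of_finset (nonZeroDivisors ℤ)
    ({a, b, c, d} : Finset ℚ)
  have hn0 : ((n : ℤ) : K) ≠ 0 := Int.cast_ne_zero.mpr (nonZeroDivisors.coe_ne_zero n)
  have clear (q : ℚ) (hq : q ∈ ({a, b, c, d} : Finset ℚ)) :
      ∃ m : ℤ, (m : K) = (n : ℤ) * q := by
    obtain ⟨m, hm⟩ := hn q hq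
    have hm' : (m : ℚ) = (n : ℤ) * q := by simpa using hm
    exact ⟨m, by exact_mod_cast congrArg (Rat.cast : ℚ → K) hm'⟩
  obtain ⟨a', ha⟩ := clear a (by simp)
  obtain ⟨b', hb⟩ := clear b (by simp)
  obtain ⟨c', hc⟩ := clear c (by simp)
  obtain ⟨d', hd⟩ := clear d (by simp)
  have hden : (c' : K) * τ + d' = (n : ℤ) * (c * τ + d) := by rw [hc, hd]; ring
  have hne' : (c' : K) * τ + d' ≠ 0 := hden ▸ mul_ne_zero hn0 hne
  refine ⟨a', b', c', d', hne', ?_⟩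
  rw [eq_div_iff hne', hden, ha, hb]
  linear_combination ((n : ℤ) : K) * h

/-- Part (2) of Lemma 9.2 (Lemma 17052301) of the paper:
if `τ₁, τ₂` are non-real algebraic numbers which are relatively independent (no
integral fractional linear transformation carries `τ₂` to `τ₁`), `A₁` has nonzero
determinant, and `A₁·(1, τ₁)ᵀ` is parallel to `A₂·(1, τ₂)ᵀ`, then `A₂ = 0`. -/
theorem parallel_jacobian_directions_relatively_independent_cusp_shapes
    (τ₁ τ₂ : ℂ) (hτ₁ : τ₁.im ≠ 0) (hτ₂ : τ₂.im ≠ 0)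
    (halg₁ : IsAlgebraic ℚ τ₁) (halg₂ : IsAlgebraic ℚ τ₂)
    (hindep : ¬ ∃ a b c d : ℤ,
        ((c : ℂ) * τ₂ + (d : ℂ) ≠ 0) ∧
        τ₁ = ((a : ℂ) * τ₂ + (b : ℂ)) / ((c : ℂ) * τ₂ + (d : ℂ)))
    (A₁ A₂ : Matrix (Fin 2) (Fin 2) ℚ) (hA₁ : A₁.det ≠ 0)
    (hpar : (A₁.map ((↑) : ℚ → ℂ)).mulVec ![1, τ₁] 0
              * (A₂.map ((↑) : ℚ → ℂ)).mulVec ![1, τ₂] 1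
          = (A₁.map ((↑) : ℚ → ℂ)).mulVec ![1, τ₁] 1
              * (A₂.map ((↑) : ℚ → ℂ)).mulVec ![1, τ₂] 0) :
    A₂ = 0 := by
  simp only [Matrix.mulVec, dotProduct, Fin.sum_univ_two, Matrix.map_apply,
    Matrix.cons_val_zero, Matrix.cons_val_one, mul_one] at hpar
  rw [Matrix.det_fin_two] at hA₁
  set p := A₁ 0 0
  set q := A₁ 0 1
  set r := A₁ 1 0
  set s := A₁ 1 1
  have key : τ₁ * (((q * A₂ 1 1 - s * A₂ 0 1 : ℚ) : ℂ) * τ₂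
        + (q * A₂ 1 0 - s * A₂ 0 0 : ℚ))
      = ((r * A₂ 0 1 - p * A₂ 1 1 : ℚ) : ℂ) * τ₂ + (r * A₂ 0 0 - p * A₂ 1 0 : ℚ) := by
    push_cast
    linear_combination hpar
  have hden := not_not.mp fun hne => hindep (exists_int_fractional_linear_of_rat hne key)
  rw [hden, mul_zero] at key
  obtain ⟨hc, hd⟩ := Complex.ratCast_mul_add_ratCast_eq_zero hτ₂ hden
  obtain ⟨ha, hb⟩ := Complex.ratCast_mul_add_ratCast_eq_zero hτ₂ key.symm
  ext i j
  refine (mul_eq_zero.mp ?_).resolve_left hA₁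
  fin_cases i <;> fin_cases j <;> dsimp
  · linear_combination -p * hd - q * hb
  · linear_combination -p * hc - q * ha
  · linear_combination -r * hd - s * hb
  · linear_combination -r * hc - s * ha
end

section
/- Let A₁ and A₂ be 2×2 integer matrices with nonzero determinants, let p₁, q₁, r₁, s₁, p₂, q₂, r₂, s₂ be integers with p₁s₁ − q₁r₁ = p₂s₂ − q₂r₂ = 1, and let n ∈ ℚ be such that [[p₁, q₁],[r₁, s₁]]·A₁⁻¹A₂ = [[1, 0],[n, 1]]·[[p₂, q₂],[r₂, s₂]] over ℚ. If ξm₁, ξl₁, ξm₂, ξl₂ are complex numbers with A₁·(ξm₁, ξl₁)ᵀ = A₂·(ξm₂, ξl₂)ᵀ and p₁ξm₁ + q₁ξl₁ = −2π√−1, then p₂ξm₂ + q₂ξl₂ = −2π√−1 and exp(r₁ξm₁ + s₁ξl₁) = e^{−2πn√−1}·exp(r₂ξm₂ + s₂ξl₂). In particular t₁ = exp(r₁ξm₁ + s₁ξl₁) and t₂ = exp(r₂ξm₂ + s₂ξl₂) are multiplicatively dependent: t₁^N = t₂^N for some positive integer N. -/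
open Matrix

/-- If `M * A₁⁻¹ * A₂ = N` over `ℚ` with `A₁`, `A₂` integral and `A₁` nonsingular, then complex
vectors with `A₁ x = A₂ y` satisfy `M x = N y`. -/
theorem mulVec_map_eq_of_mul_inv_mul_eq {ι : Type*} [Fintype ι] [DecidableEq ι]
    {A₁ A₂ : Matrix ι ι ℤ} (hA₁ : A₁.det ≠ 0) {M N : Matrix ι ι ℚ}
    (h : M * (A₁.map ((↑) : ℤ → ℚ))⁻¹ * A₂.map ((↑) : ℤ → ℚ) = N) {x y : ι → ℂ}
    (hxy : (A₁.map ((↑) : ℤ → ℂ)).mulVec x = (A₂.map ((↑) : ℤ → ℂ)).mulVec y) :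
    (M.map (Rat.castHom ℂ)).mulVec x = (N.map (Rat.castHom ℂ)).mulVec y := by
  have hcast (A : Matrix ι ι ℤ) :
      (A.map ((↑) : ℤ → ℚ)).map (Rat.castHom ℂ) = A.map ((↑) : ℤ → ℂ) := by
    ext i j
    simp
  have hdet : IsUnit (A₁.map ((↑) : ℤ → ℚ)).det := by
    rw [← Int.cast_det]
    exact isUnit_iff_ne_zero.2 (Int.cast_ne_zero.2 hA₁)
  have hM := Matrix.nonsing_inv_mul_cancel_right _ M hdet
  rw [← h]
  nth_rewrite 1 [← hM]
  simp only [Matrix.map_mul, hcast]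
  rw [← Matrix.mulVec_mulVec, hxy, Matrix.mulVec_mulVec]

/-- For rational `n`, the number `exp (-2πin)` is a root of unity of order dividing `n.den`. -/
theorem exp_neg_two_pi_mul_rat_mul_I_pow_den (n : ℚ) :
    Complex.exp (-(2 * (Real.pi : ℂ) * (n : ℂ) * Complex.I)) ^ n.den = 1 := by
  rw [← Complex.exp_nat_mul, Complex.exp_eq_one_iff]
  refine ⟨-n.num, ?_⟩
  have h : (n : ℂ) * (n.den : ℂ) = (n.num : ℂ) := by
    exact_mod_cast congrArg (Rat.cast : ℚ → ℂ) (Rat.mul_den_eq_num n)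
  push_cast
  rw [← h]
  ring

/-- Core computation in the proof of Theorem 6.9 (Theorem 21091101) of the paper:
given the matrix identity `P₁·A₁⁻¹A₂ = [[1, 0],[n, 1]]·P₂` supplied by
Lemma 21082802, every intersection point of the anomalous analytic subset
`A₁(u₁, v₁)ᵀ = A₂(u₂, v₂)ᵀ` with the first Dehn filling equation automatically
satisfies the second Dehn filling equation, and the resulting core holonomies
`t₁, t₂` are multiplicatively dependent: `t₁^N = t₂^N` for some positive `N`. -/
theorem second_dehn_equation_and_mult_dependence_from_matrix_identity
    (A₁ A₂ : Matrix (Fin 2) (Fin 2) ℤ)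
    (hA₁ : A₁.det ≠ 0) (hA₂ : A₂.det ≠ 0)
    (p₁ q₁ r₁ s₁ p₂ q₂ r₂ s₂ : ℤ)
    (hP₁ : p₁ * s₁ - q₁ * r₁ = 1) (hP₂ : p₂ * s₂ - q₂ * r₂ = 1)
    (n : ℚ)
    (hmat : !![(p₁ : ℚ), (q₁ : ℚ); (r₁ : ℚ), (s₁ : ℚ)]
          * (A₁.map ((↑) : ℤ → ℚ))⁻¹ * (A₂.map ((↑) : ℤ → ℚ))
        = !![1, 0; n, 1] * !![(p₂ : ℚ), (q₂ : ℚ); (r₂ : ℚ), (s₂ : ℚ)])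
    (ξm₁ ξl₁ ξm₂ ξl₂ : ℂ)
    (hA : (A₁.map ((↑) : ℤ → ℂ)).mulVec ![ξm₁, ξl₁]
        = (A₂.map ((↑) : ℤ → ℂ)).mulVec ![ξm₂, ξl₂])
    (hD₁ : (p₁ : ℂ) * ξm₁ + (q₁ : ℂ) * ξl₁ = -(2 * (Real.pi : ℂ) * Complex.I)) :
    (p₂ : ℂ) * ξm₂ + (q₂ : ℂ) * ξl₂ = -(2 * (Real.pi : ℂ) * Complex.I) ∧
    Complex.exp ((r₁ : ℂ) * ξm₁ + (s₁ : ℂ) * ξl₁)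
      = Complex.exp (-(2 * (Real.pi : ℂ) * (n : ℂ) * Complex.I))
        * Complex.exp ((r₂ : ℂ) * ξm₂ + (s₂ : ℂ) * ξl₂) ∧
    ∃ N : ℕ, 0 < N ∧
      Complex.exp ((r₁ : ℂ) * ξm₁ + (s₁ : ℂ) * ξl₁) ^ N
        = Complex.exp ((r₂ : ℂ) * ξm₂ + (s₂ : ℂ) * ξl₂) ^ N := by
  have h := mulVec_map_eq_of_mul_inv_mul_eq hA₁ hmat hA
  have h₀ := congrFun h 0
  have h₁ := congrFun h 1
  simp [Matrix.mulVec, dotProduct, Fin.sum_univ_two] at h₀ h₁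
  have hD₂ : (p₂ : ℂ) * ξm₂ + (q₂ : ℂ) * ξl₂ = -(2 * (Real.pi : ℂ) * Complex.I) :=
    h₀.symm.trans hD₁
  have hexp : Complex.exp ((r₁ : ℂ) * ξm₁ + (s₁ : ℂ) * ξl₁)
      = Complex.exp (-(2 * (Real.pi : ℂ) * (n : ℂ) * Complex.I))
        * Complex.exp ((r₂ : ℂ) * ξm₂ + (s₂ : ℂ) * ξl₂) := by
    rw [← Complex.exp_add]
    congr 1
    linear_combination h₁ + (n : ℂ) * hD₂
  refine ⟨hD₂, hexp, n.den, n.den_pos, ?_⟩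
  rw [hexp, mul_pow, exp_neg_two_pi_mul_rat_mul_I_pow_den, one_mul]
end
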